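/- arXiv:2211.00552 — 3 statements merged into one kernel-verified Lean document; each statement's English description precedes it below -/
import Mathlib

section
/- Let n ≥ 2 be an integer, σ ∈ (0,1), and ρ > 0. For ε ∈ (0, 2ρ) define φ(ε) := π − arctan( √(1 − (ε/(2ρ))²) / (ε/(2ρ)) ). Then the nonlocal directional curvature of the sphere of radius ρ in ℝ^n, given by the limit lim_{ε→0⁺} [ (2/(σ ε^σ)) ∫_{φ(ε)−π/2}^{0} (cos φ)^{n−2} dφ − (2/σ) ∫_{φ(ε)−π/2}^{π/2} (2ρ sin φ)^{−σ} (cos φ)^{n−2} dφ ], exists and equals −B((1−σ)/2, (n−1)/2) / (σ (2ρ)^σ), where B(x,y) = Γ(x)Γ(y)/Γ(x+y) is the beta function. In particular this value is independent of the point on the sphere and of the tangent direction. -/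
open MeasureTheory Real Filter
open scoped Topology

/-- The beta function `B(x,y) = Γ(x)Γ(y)/Γ(x+y)`. -/
noncomputable def betaFn (x y : ℝ) : ℝ := Real.Gamma x * Real.Gamma y / Real.Gamma (x + y)

theorem integrableOn_Ioo_rpow_mul_one_sub_rpow {a b : ℝ} (ha : 0 < a) (hb : 0 < b) :
    IntegrableOn (fun x : ℝ => x ^ (a - 1) * (1 - x) ^ (b - 1)) (Set.Ioo 0 1) := by
  have h := Complex.betaIntegral_convergent (u := a) (v := b) (by simpa) (by simpa)
  rw [intervalIntegrable_iff_integrableOn_Ioo_of_le zero_le_one] at h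
  have h' : IntegrableOn (fun x : ℝ =>
      ((x : ℂ) ^ ((a : ℂ) - 1) * (1 - (x : ℂ)) ^ ((b : ℂ) - 1)).re) (Set.Ioo 0 1) := h.re
  refine h'.congr_fun (fun x hx => ?_) measurableSet_Ioo
  beta_reduce
  norm_cast
  rw [← Complex.ofReal_cpow hx.1.le, ← Complex.ofReal_cpow (by linarith [hx.2]),
    Complex.re_mul_ofReal, Complex.ofReal_re]

theorem integral_Ioo_rpow_mul_one_sub_rpow {a b : ℝ} (ha : 0 < a) (hb : 0 < b) :
    ∫ x in Set.Ioo (0 : ℝ) 1, x ^ (a - 1) * (1 - x) ^ (b - 1) = betaFn a b := by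
  have h := Complex.betaIntegral_convergent (u := a) (v := b) (by simpa) (by simpa)
  rw [intervalIntegrable_iff_integrableOn_Ioo_of_le zero_le_one] at h
  change _ = ProbabilityTheory.beta a b
  rw [ProbabilityTheory.beta_eq_betaIntegralReal a b ha hb, Complex.betaIntegral,
    intervalIntegral.integral_of_le zero_le_one, integral_Ioc_eq_integral_Ioo,
    ← RCLike.re_to_complex, ← integral_re h]
  refine setIntegral_congr_fun measurableSet_Ioo fun x hx => ?_
  norm_cast
  rw [← Complex.ofReal_cpow hx.1.le, ← Complex.ofReal_cpow (by linarith [hx.2]),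
    RCLike.re_to_complex, Complex.re_mul_ofReal, Complex.ofReal_re]

theorem injOn_sin_sq_Ioo : Set.InjOn (fun x : ℝ => sin x ^ 2) (Set.Ioo 0 (π / 2)) := by
  intro x hx y hy h
  have hsin : sin x = sin y :=
    (pow_left_inj₀ (sin_pos_of_pos_of_lt_pi hx.1 (by linarith [hx.2, pi_pos])).le
      (sin_pos_of_pos_of_lt_pi hy.1 (by linarith [hy.2, pi_pos])).le two_ne_zero).1 h
  exact injOn_sin ⟨by linarith [hx.1, pi_pos], hx.2.le⟩ ⟨by linarith [hy.1, pi_pos], hy.2.le⟩ hsin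

theorem image_sin_sq_Ioo : (fun x : ℝ => sin x ^ 2) '' Set.Ioo 0 (π / 2) = Set.Ioo 0 1 := by
  ext u
  constructor
  · rintro ⟨x, hx, rfl⟩
    have hs := sin_pos_of_pos_of_lt_pi hx.1 (by linarith [hx.2, pi_pos])
    have hc := cos_pos_of_mem_Ioo ⟨by linarith [hx.1, pi_pos], hx.2⟩
    exact ⟨by positivity, by nlinarith [sin_sq_add_cos_sq x]⟩
  · rintro ⟨h0, h1⟩
    have hs : 0 < √u := sqrt_pos.2 h0
    have hs1 : √u < 1 := by rw [sqrt_lt' one_pos]; simpa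
    refine ⟨arcsin √u, ⟨arcsin_pos.2 hs, arcsin_lt_pi_div_two.2 hs1⟩, ?_⟩
    simp only
    rw [sin_arcsin (by linarith) hs1.le, sq_sqrt h0.le]

theorem deriv_sin_sq_smul_beta_integrand (a b : ℝ) {x : ℝ} (hx : x ∈ Set.Ioo 0 (π / 2)) :
    |2 * sin x * cos x| • ((sin x ^ 2) ^ (a - 1) * (1 - sin x ^ 2) ^ (b - 1)) =
      2 * (sin x ^ (2 * a - 1) * cos x ^ (2 * b - 1)) := by
  have hs := sin_pos_of_pos_of_lt_pi hx.1 (by linarith [hx.2, pi_pos])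
  have hc := cos_pos_of_mem_Ioo ⟨by linarith [hx.1, pi_pos], hx.2⟩
  have h {y : ℝ} (hy : 0 < y) (c : ℝ) : y ^ (2 * c - 1) = y * (y ^ 2) ^ (c - 1) := by
    rw [← rpow_natCast y 2, ← rpow_mul hy.le]
    nth_rewrite 2 [← rpow_one y]
    rw [← rpow_add hy]
    congr 1
    push_cast
    ring
  rw [abs_of_pos (by positivity), smul_eq_mul, ← cos_sq', h hs, h hc]
  ring

theorem hasDerivWithinAt_sin_sq (s : Set ℝ) (x : ℝ) :
    HasDerivWithinAt (fun x : ℝ => sin x ^ 2) (2 * sin x * cos x) s x := by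
  have h := ((hasDerivAt_sin x).fun_pow 2).hasDerivWithinAt (s := s)
  norm_num at h
  exact h

theorem integrableOn_Ioo_sin_rpow_mul_cos_rpow {a b : ℝ} (ha : 0 < a) (hb : 0 < b) :
    IntegrableOn (fun x : ℝ => sin x ^ (2 * a - 1) * cos x ^ (2 * b - 1))
      (Set.Ioo 0 (π / 2)) := by
  have h := integrableOn_Ioo_rpow_mul_one_sub_rpow ha hb
  rw [← image_sin_sq_Ioo, integrableOn_image_iff_integrableOn_abs_deriv_smul measurableSet_Ioo
    (fun x _ => hasDerivWithinAt_sin_sq _ x) injOn_sin_sq_Ioo] at h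
  have h2 := h.congr_fun (fun x hx => deriv_sin_sq_smul_beta_integrand a b hx) measurableSet_Ioo
  simpa [IntegrableOn] using h2.const_mul 2⁻¹

theorem integral_Ioo_sin_rpow_mul_cos_rpow {a b : ℝ} (ha : 0 < a) (hb : 0 < b) :
    ∫ x in Set.Ioo 0 (π / 2), sin x ^ (2 * a - 1) * cos x ^ (2 * b - 1) = betaFn a b / 2 := by
  rw [← integral_Ioo_rpow_mul_one_sub_rpow ha hb, ← image_sin_sq_Ioo,
    integral_image_eq_integral_abs_deriv_smul measurableSet_Ioo
      (fun x _ => hasDerivWithinAt_sin_sq _ x) injOn_sin_sq_Ioo,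
    setIntegral_congr_fun measurableSet_Ioo
      (fun x hx => deriv_sin_sq_smul_beta_integrand a b hx), integral_const_mul]
  ring

theorem sphere_kernel_eq {n : ℕ} (hn : 2 ≤ n) {ρ : ℝ} (hρ : 0 < ρ) (σ : ℝ) {x : ℝ}
    (hx : x ∈ Set.Ioo 0 (π / 2)) :
    (2 * ρ) ^ (-σ) * (sin x ^ (2 * ((1 - σ) / 2) - 1) *
      cos x ^ (2 * (((n : ℝ) - 1) / 2) - 1)) =
      (2 * ρ * sin x) ^ (-σ) * cos x ^ (n - 2) := by
  have hs := sin_pos_of_pos_of_lt_pi hx.1 (by linarith [hx.2, pi_pos])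
  rw [mul_rpow (by positivity) hs.le, ← rpow_natCast (cos x) (n - 2), Nat.cast_sub hn, mul_assoc]
  congr 3 <;> push_cast <;> ring_nf

theorem integrableOn_sphere_kernel {n : ℕ} (hn : 2 ≤ n) {σ ρ : ℝ} (hσ : σ < 1) (hρ : 0 < ρ) :
    IntegrableOn (fun x : ℝ => (2 * ρ * sin x) ^ (-σ) * cos x ^ (n - 2))
      (Set.Ioo 0 (π / 2)) := by
  have hn' : (2 : ℝ) ≤ n := by exact_mod_cast hn
  have h : IntegrableOn _ (Set.Ioo 0 (π / 2)) :=
    (integrableOn_Ioo_sin_rpow_mul_cos_rpow (a := (1 - σ) / 2) (b := ((n : ℝ) - 1) / 2)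
      (by linarith) (by linarith)).const_mul ((2 * ρ) ^ (-σ))
  exact h.congr_fun (fun x hx => sphere_kernel_eq hn hρ σ hx) measurableSet_Ioo

theorem integral_sphere_kernel {n : ℕ} (hn : 2 ≤ n) {σ ρ : ℝ} (hσ : σ < 1) (hρ : 0 < ρ) :
    ∫ x in Set.Ioo 0 (π / 2), (2 * ρ * sin x) ^ (-σ) * cos x ^ (n - 2) =
      (2 * ρ) ^ (-σ) * (betaFn ((1 - σ) / 2) (((n : ℝ) - 1) / 2) / 2) := by
  have hn' : (2 : ℝ) ≤ n := by exact_mod_cast hn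
  rw [← setIntegral_congr_fun measurableSet_Ioo (fun x hx => sphere_kernel_eq hn hρ σ hx),
    integral_const_mul, integral_Ioo_sin_rpow_mul_cos_rpow (by linarith) (by linarith)]

theorem pi_sub_arctan_sub_pi_div_two_eq_arcsin {t : ℝ} (ht : 0 < t) :
    π - arctan (√(1 - t ^ 2) / t) - π / 2 = arcsin t := by
  rw [← arccos_eq_arctan ht, arccos]
  ring

theorem tendsto_setIntegral_Ioo_left {f : ℝ → ℝ} {a b : ℝ} (hab : a < b)
    (hf : IntegrableOn f (Set.Ioo a b)) :
    Tendsto (fun x => ∫ y in Set.Ioo x b, f y) (𝓝[>] a) (𝓝 (∫ y in Set.Ioo a b, f y)) := by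
  have hcont := intervalIntegral.continuousOn_primitive_interval_left (f := f) (a := a) (b := b)
    (μ := volume) (by rwa [Set.uIcc_of_le hab.le, integrableOn_Icc_iff_integrableOn_Ioo])
  have h := (hcont a Set.left_mem_uIcc).tendsto.mono_left
    (nhdsWithin_mono a (Set.Ioo_subset_Icc_self.trans Set.Icc_subset_uIcc))
  rw [nhdsWithin_Ioo_eq_nhdsGT hab, intervalIntegral.integral_of_le hab.le,
    integral_Ioc_eq_integral_Ioo] at h
  refine h.congr' ?_
  filter_upwards [Ioo_mem_nhdsGT hab] with x hx
  rw [intervalIntegral.integral_of_le hx.2.le, integral_Ioc_eq_integral_Ioo]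

theorem tendsto_arcsin_div_nhdsGT {c : ℝ} (hc : 0 < c) :
    Tendsto (fun ε : ℝ => arcsin (ε / c)) (𝓝[>] 0) (𝓝[>] 0) := by
  refine tendsto_nhdsWithin_iff.2 ⟨?_, ?_⟩
  · have h : Continuous fun ε : ℝ => arcsin (ε / c) := by fun_prop
    simpa using (h.tendsto 0).mono_left nhdsWithin_le_nhds
  · filter_upwards [self_mem_nhdsWithin] with ε hε
    exact arcsin_pos.2 (div_pos hε hc)

theorem arcsin_le_pi_div_two_mul {t : ℝ} (h0 : 0 ≤ t) (h1 : t ≤ 1) :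
    arcsin t ≤ π / 2 * t := by
  have h := mul_le_sin (arcsin_nonneg.2 h0) (arcsin_le_pi_div_two t)
  rw [sin_arcsin (by linarith) h1] at h
  calc arcsin t = π / 2 * (2 / π * arcsin t) := by field_simp
    _ ≤ π / 2 * t := by gcongr

theorem tendsto_cap_term (m : ℕ) {σ c : ℝ} (hσ : σ ∈ Set.Ioo 0 1) (hc : 0 < c) :
    Tendsto (fun ε : ℝ => 2 / (σ * ε ^ σ) * ∫ x in (arcsin (ε / c))..(0 : ℝ), cos x ^ m)
      (𝓝[>] 0) (𝓝 0) := by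
  obtain ⟨hσ0, hσ1⟩ := hσ
  have hlim : Tendsto (fun ε : ℝ => π / (σ * c) * ε ^ (1 - σ)) (𝓝[>] 0) (𝓝 0) := by
    have h := (continuousAt_rpow_const (0 : ℝ) (1 - σ) (Or.inr (by linarith))).tendsto.const_mul
      (π / (σ * c))
    rw [zero_rpow (by linarith), mul_zero] at h
    exact h.mono_left nhdsWithin_le_nhds
  refine squeeze_zero_norm' ?_ hlim
  filter_upwards [Ioo_mem_nhdsGT hc] with ε hε
  have hε0 : 0 < ε := hε.1
  have hpow : 0 < ε ^ σ := rpow_pos_of_pos hε0 σ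
  have ht0 : 0 ≤ ε / c := by positivity
  have hint : ‖∫ x in (arcsin (ε / c))..(0 : ℝ), cos x ^ m‖ ≤ π / 2 * (ε / c) := by
    refine (intervalIntegral.norm_integral_le_of_norm_le_const (C := 1) fun x _ => ?_).trans ?_
    · rw [norm_pow]
      exact pow_le_one₀ (norm_nonneg _) (abs_cos_le_one x)
    · rw [one_mul, zero_sub, abs_neg, abs_of_nonneg (arcsin_nonneg.2 ht0)]
      exact arcsin_le_pi_div_two_mul ht0 ((div_le_one hc).2 hε.2.le)
  rw [norm_mul, Real.norm_of_nonneg (by positivity)]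
  calc 2 / (σ * ε ^ σ) * ‖∫ x in (arcsin (ε / c))..(0 : ℝ), cos x ^ m‖
      ≤ 2 / (σ * ε ^ σ) * (π / 2 * (ε / c)) := by gcongr
    _ = π / (σ * c) * ε ^ (1 - σ) := by
      rw [rpow_sub hε0, rpow_one]
      field_simp

/-- The nonlocal directional curvature of a sphere of radius `ρ` in `ℝⁿ` equals
`−B((1−σ)/2, (n−1)/2)/(σ (2ρ)^σ)`. -/
theorem nonlocal_directional_curvature_sphere (n : ℕ) (hn : 2 ≤ n) (σ ρ : ℝ)
    (hσ : σ ∈ Set.Ioo 0 1) (hρ : 0 < ρ) :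
    Tendsto
      (fun ε : ℝ =>
        (2 / (σ * ε ^ σ)) *
            (∫ φ in ((π - Real.arctan (Real.sqrt (1 - (ε / (2 * ρ)) ^ 2) / (ε / (2 * ρ)))) -
                π / 2)..(0 : ℝ), (Real.cos φ) ^ (n - 2)) -
          (2 / σ) *
            ∫ φ in Set.Ioo
                ((π - Real.arctan (Real.sqrt (1 - (ε / (2 * ρ)) ^ 2) / (ε / (2 * ρ)))) - π / 2)
                (π / 2), (2 * ρ * Real.sin φ) ^ (-σ) * (Real.cos φ) ^ (n - 2))
      (𝓝[>] 0) (𝓝 (-(betaFn ((1 - σ) / 2) (((n : ℝ) - 1) / 2) / (σ * (2 * ρ) ^ σ)))) := by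
  obtain ⟨hσ0, hσ1⟩ := hσ
  have hc : 0 < 2 * ρ := by positivity
  have hmain := ((tendsto_setIntegral_Ioo_left pi_div_two_pos
    (integrableOn_sphere_kernel hn hσ1 hρ)).comp (tendsto_arcsin_div_nhdsGT hc)).const_mul (2 / σ)
  have h := (tendsto_cap_term (n - 2) ⟨hσ0, hσ1⟩ hc).sub hmain
  rw [integral_sphere_kernel hn hσ1 hρ, rpow_neg hc.le] at h
  have hval : 0 - 2 / σ * (((2 * ρ) ^ σ)⁻¹ * (betaFn ((1 - σ) / 2) (((n : ℝ) - 1) / 2) / 2)) =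
      -(betaFn ((1 - σ) / 2) (((n : ℝ) - 1) / 2) / (σ * (2 * ρ) ^ σ)) := by
    have hpow := rpow_pos_of_pos hc σ
    field_simp
    ring
  rw [hval] at h
  refine h.congr' ?_
  filter_upwards [self_mem_nhdsWithin] with ε hε
  rw [pi_sub_arctan_sub_pi_div_two_eq_arcsin (div_pos hε hc)]
  rfl
end

section
/- Let n ≥ 1 be an integer and let g_t(u) := (4πt)^{−n/2} exp(−|u|²/(4t)) be the Gauss–Weierstrass kernel on ℝ^n. Then for all s, t > 0 and all v ∈ ℝ^n, the endomorphism-valued integral H(v,s,t) := ∫_{ℝ^n} (v−u) ⊗ u · g_s(v−u) g_t(u) du satisfies H(v,s,t) = ( (st/(s+t)²) v ⊗ v − (2st/(s+t)) Id ) g_{s+t}(v), where Id is the identity endomorphism of ℝ^n. -/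
open MeasureTheory Real Filter
open scoped Topology InnerProductSpace

/-- The outer product `a ⊗ b` of two vectors, i.e. the linear map `x ↦ (b·x) a`. -/
noncomputable def outer {n : ℕ} (a b : EuclideanSpace ℝ (Fin n)) :
    EuclideanSpace ℝ (Fin n) →L[ℝ] EuclideanSpace ℝ (Fin n) :=
  (innerSL ℝ b).smulRight a

/-- The Gauss–Weierstrass kernel `g_t(u) = (4πt)^{-n/2} exp(-|u|²/(4t))` on `ℝⁿ`. -/
noncomputable def gauss (n : ℕ) (t : ℝ) (u : EuclideanSpace ℝ (Fin n)) : ℝ :=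
  (4 * π * t) ^ (-(n : ℝ) / 2) * Real.exp (-‖u‖ ^ 2 / (4 * t))

lemma hasFDerivAt_exp_neg_mul_sq_norm {V : Type*} [NormedAddCommGroup V]
    [InnerProductSpace ℝ V] (b : ℝ) (w : V) :
    HasFDerivAt (fun w : V => rexp (-b * ‖w‖ ^ 2))
      (rexp (-b * ‖w‖ ^ 2) • (-b) • (2 • innerSL ℝ w)) w :=
  ((hasStrictFDerivAt_norm_sq w).hasFDerivAt.const_mul (-b)).exp

section GaussianMoments

variable {V : Type*} [NormedAddCommGroup V] [InnerProductSpace ℝ V] [FiniteDimensional ℝ V]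
  [MeasurableSpace V] [BorelSpace V]

lemma integrable_exp_neg_mul_sq_norm {b : ℝ} (hb : 0 < b) :
    Integrable fun w : V => rexp (-b * ‖w‖ ^ 2) := by
  have h := (GaussianFourier.integrable_cexp_neg_mul_sq_norm_add
    (show 0 < (b : ℂ).re from hb) 0 (0 : V)).norm
  refine h.congr (ae_of_all _ fun w => ?_)
  simp only [Complex.norm_exp]
  congr 1
  simp [← Complex.ofReal_pow]

lemma integrable_exp_neg_mul_sq_norm_mul_sq {b : ℝ} (hb : 0 < b) :
    Integrable fun w : V => rexp (-b * ‖w‖ ^ 2) * ‖w‖ ^ 2 := by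
  refine ((integrable_exp_neg_mul_sq_norm (V := V) (half_pos hb)).const_mul (2 / b)).mono'
    (by fun_prop) (ae_of_all _ fun w => ?_)
  rw [Real.norm_of_nonneg (by positivity)]
  have h1 : b / 2 * ‖w‖ ^ 2 ≤ rexp (b / 2 * ‖w‖ ^ 2) :=
    (le_add_of_nonneg_right zero_le_one).trans (Real.add_one_le_exp _)
  have h2 : ‖w‖ ^ 2 ≤ 2 / b * rexp (b / 2 * ‖w‖ ^ 2) := by
    rw [div_mul_eq_mul_div, le_div_iff₀ hb]
    linarith
  calc rexp (-b * ‖w‖ ^ 2) * ‖w‖ ^ 2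
      ≤ rexp (-b * ‖w‖ ^ 2) * (2 / b * rexp (b / 2 * ‖w‖ ^ 2)) := by gcongr
    _ = 2 / b * (rexp (-b * ‖w‖ ^ 2) * rexp (b / 2 * ‖w‖ ^ 2)) := by ring
    _ = 2 / b * rexp (-(b / 2) * ‖w‖ ^ 2) := by
      rw [← Real.exp_add]
      ring_nf

/-- A continuous function of at most quadratic growth is integrable against a Gaussian. -/
lemma integrable_exp_neg_mul_sq_norm_smul {F : Type*} [NormedAddCommGroup F] [NormedSpace ℝ F]
    {b : ℝ} (hb : 0 < b) {f : V → F} (hf : Continuous f) (C : ℝ)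
    (hC : ∀ w, ‖f w‖ ≤ C * (1 + ‖w‖ ^ 2)) :
    Integrable fun w : V => rexp (-b * ‖w‖ ^ 2) • f w := by
  refine (((integrable_exp_neg_mul_sq_norm (V := V) hb).add
    (integrable_exp_neg_mul_sq_norm_mul_sq hb)).const_mul C).mono'
    (Continuous.aestronglyMeasurable (by fun_prop)) (ae_of_all _ fun w => ?_)
  rw [norm_smul, Real.norm_of_nonneg (Real.exp_pos _).le, Pi.add_apply]
  calc rexp (-b * ‖w‖ ^ 2) * ‖f w‖ ≤ rexp (-b * ‖w‖ ^ 2) * (C * (1 + ‖w‖ ^ 2)) := by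
        gcongr
        exact hC w
    _ = _ := by ring

lemma integrable_exp_neg_mul_sq_norm_mul_inner {b : ℝ} (hb : 0 < b) (x : V) :
    Integrable fun w : V => rexp (-b * ‖w‖ ^ 2) * ⟪w, x⟫_ℝ := by
  refine integrable_exp_neg_mul_sq_norm_smul hb (f := fun w => ⟪w, x⟫_ℝ) (by fun_prop) ‖x‖
    fun w => (norm_inner_le_norm w x).trans ?_
  nlinarith [norm_nonneg x, mul_nonneg (norm_nonneg x) (sq_nonneg (‖w‖ - 1)),
    mul_nonneg (norm_nonneg x) (sq_nonneg ‖w‖)]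

lemma integrable_exp_neg_mul_sq_norm_mul_inner_mul_inner {b : ℝ} (hb : 0 < b) (x y : V) :
    Integrable fun w : V => rexp (-b * ‖w‖ ^ 2) * (⟪w, x⟫_ℝ * ⟪w, y⟫_ℝ) := by
  refine integrable_exp_neg_mul_sq_norm_smul hb (f := fun w => ⟪w, x⟫_ℝ * ⟪w, y⟫_ℝ)
    (by fun_prop) (‖x‖ * ‖y‖) fun w => ?_
  rw [norm_mul]
  calc ‖⟪w, x⟫_ℝ‖ * ‖⟪w, y⟫_ℝ‖ ≤ (‖w‖ * ‖x‖) * (‖w‖ * ‖y‖) := by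
        gcongr <;> exact norm_inner_le_norm _ _
    _ = ‖x‖ * ‖y‖ * ‖w‖ ^ 2 := by ring
    _ ≤ ‖x‖ * ‖y‖ * (1 + ‖w‖ ^ 2) := by
        gcongr
        linarith

lemma integral_exp_neg_mul_sq_norm_mul_inner (b : ℝ) (x : V) :
    ∫ w : V, rexp (-b * ‖w‖ ^ 2) * ⟪w, x⟫_ℝ = 0 := by
  have h := integral_neg_eq_self (fun w : V => rexp (-b * ‖w‖ ^ 2) * ⟪w, x⟫_ℝ) volume
  simp only [norm_neg, inner_neg_left, mul_neg, integral_neg] at h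
  linarith

/-- The second moments of a Gaussian, by integration by parts. -/
lemma integral_exp_neg_mul_sq_norm_mul_inner_mul_inner {b : ℝ} (hb : 0 < b) (x y : V) :
    ∫ w : V, rexp (-b * ‖w‖ ^ 2) * (⟪w, x⟫_ℝ * ⟪w, y⟫_ℝ) =
      ⟪x, y⟫_ℝ / (2 * b) * ∫ w : V, rexp (-b * ‖w‖ ^ 2) := by
  have hx : ∀ w : V, HasFDerivAt (fun w : V => ⟪x, w⟫_ℝ) (innerSL ℝ x) w :=
    fun w => (innerSL ℝ x).hasFDerivAt
  have hfg' : ∀ w : V, ⟪x, w⟫_ℝ * (rexp (-b * ‖w‖ ^ 2) • (-b) • (2 • innerSL ℝ w)) y =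
      -(2 * b) * (rexp (-b * ‖w‖ ^ 2) * (⟪w, x⟫_ℝ * ⟪w, y⟫_ℝ)) := fun w => by
    simp [real_inner_comm x w]
    ring
  have key := integral_bilinear_hasFDerivAt_right_eq_neg_left_of_integrable
    (μ := (volume : Measure V)) (v := y) (B := ContinuousLinearMap.mul ℝ ℝ)
    (f := fun w => ⟪x, w⟫_ℝ) (f' := fun _ => innerSL ℝ x)
    (g := fun w => rexp (-b * ‖w‖ ^ 2))
    ((integrable_exp_neg_mul_sq_norm hb).const_mul _)
    (((integrable_exp_neg_mul_sq_norm_mul_inner_mul_inner hb x y).const_mul (-(2 * b))).congr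
      (ae_of_all _ fun w => (hfg' w).symm))
    ((integrable_exp_neg_mul_sq_norm_mul_inner hb x).congr
      (ae_of_all _ fun w => by simp [real_inner_comm x w, mul_comm]))
    (fun w _ => hx w) (fun w _ => hasFDerivAt_exp_neg_mul_sq_norm b w)
  simp only [ContinuousLinearMap.mul_apply', hfg', innerSL_apply_apply, integral_const_mul] at key
  rw [div_mul_eq_mul_div, eq_div_iff (by positivity)]
  linarith

end GaussianMoments

lemma gauss_eq (n : ℕ) (t : ℝ) (u : EuclideanSpace ℝ (Fin n)) :
    gauss n t u = (4 * π * t) ^ (-(n : ℝ) / 2) * rexp (-(1 / (4 * t)) * ‖u‖ ^ 2) := by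
  rw [gauss]
  ring_nf

lemma integral_gauss (n : ℕ) {t : ℝ} (ht : 0 < t) :
    ∫ u : EuclideanSpace ℝ (Fin n), gauss n t u = 1 := by
  simp only [gauss_eq, integral_const_mul]
  rw [GaussianFourier.integral_rexp_neg_mul_sq_norm (by positivity), finrank_euclideanSpace_fin,
    show π / (1 / (4 * t)) = 4 * π * t by field_simp, ← Real.rpow_add (by positivity)]
  simp [neg_div]

lemma integrable_gauss (n : ℕ) {t : ℝ} (ht : 0 < t) : Integrable (gauss n t) := by
  simpa only [← gauss_eq] using
    (integrable_exp_neg_mul_sq_norm (V := EuclideanSpace ℝ (Fin n))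
      (b := 1 / (4 * t)) (by positivity)).const_mul ((4 * π * t) ^ (-(n : ℝ) / 2))

lemma integrable_gauss_mul_inner {n : ℕ} {t : ℝ} (ht : 0 < t) (x : EuclideanSpace ℝ (Fin n)) :
    Integrable fun u => gauss n t u * ⟪u, x⟫_ℝ := by
  simpa only [← mul_assoc, ← gauss_eq] using
    (integrable_exp_neg_mul_sq_norm_mul_inner (b := 1 / (4 * t)) (by positivity) x).const_mul
      ((4 * π * t) ^ (-(n : ℝ) / 2))

lemma integrable_gauss_mul_inner_mul_inner {n : ℕ} {t : ℝ} (ht : 0 < t)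
    (x y : EuclideanSpace ℝ (Fin n)) :
    Integrable fun u => gauss n t u * (⟪u, x⟫_ℝ * ⟪u, y⟫_ℝ) := by
  simpa only [← mul_assoc, ← gauss_eq] using
    (integrable_exp_neg_mul_sq_norm_mul_inner_mul_inner (b := 1 / (4 * t)) (by positivity)
      x y).const_mul ((4 * π * t) ^ (-(n : ℝ) / 2))

lemma integral_gauss_mul_inner {n : ℕ} (t : ℝ) (x : EuclideanSpace ℝ (Fin n)) :
    ∫ u, gauss n t u * ⟪u, x⟫_ℝ = 0 := by
  simp only [gauss_eq, mul_assoc, integral_const_mul]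
  rw [integral_exp_neg_mul_sq_norm_mul_inner, mul_zero]

lemma integral_gauss_mul_inner_mul_inner {n : ℕ} {t : ℝ} (ht : 0 < t)
    (x y : EuclideanSpace ℝ (Fin n)) :
    ∫ u, gauss n t u * (⟪u, x⟫_ℝ * ⟪u, y⟫_ℝ) = 2 * t * ⟪x, y⟫_ℝ := by
  have h := integral_gauss n ht
  simp only [gauss_eq, integral_const_mul] at h
  simp only [gauss_eq, mul_assoc ((4 * π * t) ^ (-(n : ℝ) / 2)), integral_const_mul]
  rw [integral_exp_neg_mul_sq_norm_mul_inner_mul_inner (by positivity), mul_left_comm, h]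
  field_simp
  ring

/-- Completing the square in a product of two heat kernels. -/
lemma gauss_sub_mul_gauss (n : ℕ) {s t : ℝ} (hs : 0 < s) (ht : 0 < t)
    (u v : EuclideanSpace ℝ (Fin n)) :
    gauss n s (v - u) * gauss n t u =
      gauss n (s + t) v * gauss n (s * t / (s + t)) (u - (t / (s + t)) • v) := by
  have hst : 0 < s + t := add_pos hs ht
  simp only [gauss]
  rw [mul_mul_mul_comm, mul_mul_mul_comm _ _ ((4 * π * (s * t / (s + t))) ^ _),
    ← Real.mul_rpow (by positivity) (by positivity),
    ← Real.mul_rpow (by positivity) (by positivity), ← Real.exp_add, ← Real.exp_add]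
  congr 2
  · field_simp
  · rw [norm_sub_sq_real, norm_sub_sq_real, norm_smul, real_inner_smul_right,
      Real.norm_of_nonneg (by positivity), real_inner_comm]
    field_simp
    ring

lemma outer_apply {n : ℕ} (a b x : EuclideanSpace ℝ (Fin n)) : outer a b x = ⟪b, x⟫_ℝ • a := rfl

lemma continuous_outer {n : ℕ} :
    Continuous fun p : EuclideanSpace ℝ (Fin n) × EuclideanSpace ℝ (Fin n) => outer p.1 p.2 := by
  unfold outer
  exact (((ContinuousLinearMap.smulRightL ℝ (EuclideanSpace ℝ (Fin n))
    (EuclideanSpace ℝ (Fin n))).continuous.comp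
      ((innerSL ℝ).continuous.comp continuous_snd)).clm_apply continuous_fst)

lemma integrable_gauss_smul_outer {n : ℕ} {t : ℝ} (ht : 0 < t)
    (a b : EuclideanSpace ℝ (Fin n)) :
    Integrable fun w => gauss n t w • outer (a - w) (w + b) := by
  have hc : Continuous fun w : EuclideanSpace ℝ (Fin n) => outer (a - w) (w + b) :=
    continuous_outer.comp (f := fun w : EuclideanSpace ℝ (Fin n) => (a - w, w + b)) (by fun_prop)
  have h := (integrable_exp_neg_mul_sq_norm_smul (b := 1 / (4 * t)) (by positivity) hc
    ((‖a‖ + 1) * (‖b‖ + 1) * 2) fun w => ?_).smul ((4 * π * t) ^ (-(n : ℝ) / 2))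
  · exact h.congr (ae_of_all _ fun w => by simp only [gauss_eq, mul_smul, Pi.smul_apply])
  · rw [outer, ContinuousLinearMap.norm_smulRight_apply, innerSL_apply_norm]
    have h1 : ‖w + b‖ ≤ (‖b‖ + 1) * (1 + ‖w‖) := by
      nlinarith [norm_add_le w b, norm_nonneg b, norm_nonneg w,
        mul_nonneg (norm_nonneg b) (norm_nonneg w)]
    have h2 : ‖a - w‖ ≤ (‖a‖ + 1) * (1 + ‖w‖) := by
      nlinarith [norm_sub_le a w, norm_nonneg a, norm_nonneg w,
        mul_nonneg (norm_nonneg a) (norm_nonneg w)]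
    calc ‖w + b‖ * ‖a - w‖ ≤ ((‖b‖ + 1) * (1 + ‖w‖)) * ((‖a‖ + 1) * (1 + ‖w‖)) := by gcongr
      _ = (‖a‖ + 1) * (‖b‖ + 1) * (1 + ‖w‖) ^ 2 := by ring
      _ ≤ (‖a‖ + 1) * (‖b‖ + 1) * (2 * (1 + ‖w‖ ^ 2)) := by
        gcongr
        nlinarith [sq_nonneg (‖w‖ - 1)]
      _ = _ := by ring

lemma integral_gauss_smul_outer {n : ℕ} {t : ℝ} (ht : 0 < t) (a b : EuclideanSpace ℝ (Fin n)) :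
    ∫ w, gauss n t w • outer (a - w) (w + b) =
      outer a b - (2 * t) • ContinuousLinearMap.id ℝ (EuclideanSpace ℝ (Fin n)) := by
  have hint := integrable_gauss_smul_outer ht a b
  ext1 x
  refine ext_inner_left ℝ fun y => ?_
  rw [ContinuousLinearMap.integral_apply hint, ← integral_inner (hint.apply_continuousLinearMap x)]
  have hexp : ∀ w, ⟪y, (gauss n t w • outer (a - w) (w + b)) x⟫_ℝ =
      gauss n t w * (⟪b, x⟫_ℝ * ⟪y, a⟫_ℝ) + gauss n t w * ⟪w, x⟫_ℝ * ⟪y, a⟫_ℝ -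
        gauss n t w * ⟪w, y⟫_ℝ * ⟪b, x⟫_ℝ - gauss n t w * (⟪w, x⟫_ℝ * ⟪w, y⟫_ℝ) := fun w => by
    simp only [smul_apply, outer_apply, inner_smul_right, inner_sub_right, inner_add_left,
      real_inner_comm w y]
    ring
  have h0 := (integrable_gauss n ht).mul_const (⟪b, x⟫_ℝ * ⟪y, a⟫_ℝ)
  have h1 := (integrable_gauss_mul_inner ht x).mul_const ⟪y, a⟫_ℝ
  have h2 := (integrable_gauss_mul_inner ht y).mul_const ⟪b, x⟫_ℝ
  have h3 := integrable_gauss_mul_inner_mul_inner ht x y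
  simp only [hexp]
  rw [integral_sub ((h0.fun_add h1).sub' h2) h3, integral_sub (h0.fun_add h1) h2, integral_add h0 h1,
    integral_mul_const, integral_mul_const, integral_mul_const, integral_gauss n ht,
    integral_gauss_mul_inner, integral_gauss_mul_inner, integral_gauss_mul_inner_mul_inner ht]
  simp [outer_apply, inner_sub_right, inner_smul_right, real_inner_comm x y]

theorem integral_outer_gauss_conv (n : ℕ) (hn : 1 ≤ n) (s t : ℝ) (hs : 0 < s) (ht : 0 < t)
    (v : EuclideanSpace ℝ (Fin n)) :
    ∫ u : EuclideanSpace ℝ (Fin n), (gauss n s (v - u) * gauss n t u) • outer (v - u) u =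
      gauss n (s + t) v •
        ((s * t / (s + t) ^ 2) • outer v v -
          (2 * s * t / (s + t)) • ContinuousLinearMap.id ℝ (EuclideanSpace ℝ (Fin n))) := by
  have hst : 0 < s + t := add_pos hs ht
  simp only [gauss_sub_mul_gauss n hs ht, mul_smul, integral_smul]
  congr 1
  set m : EuclideanSpace ℝ (Fin n) := (t / (s + t)) • v with hm
  have hvm : v - m = (s / (s + t)) • v := by
    rw [hm, sub_eq_iff_eq_add, ← add_smul, ← add_div, div_self hst.ne', one_smul]
  calc ∫ u, gauss n (s * t / (s + t)) (u - m) • outer (v - u) u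
      = ∫ w, gauss n (s * t / (s + t)) w • outer (v - m - w) (w + m) := by
        rw [← integral_add_right_eq_self _ m]
        simp only [add_sub_cancel_right, sub_sub, add_comm]
    _ = _ := by
        rw [integral_gauss_smul_outer (by positivity), hvm]
        congr 1
        · ext1 x
          simp only [hm, outer_apply, smul_apply, smul_smul, real_inner_smul_left]
          congr 1
          field_simp
        · congr 1
          ring
end

section
/- (Fractional Hessian formula.) Let n ≥ 1 be an integer, α, β ∈ (0,1), and let f : ℝ^n → ℝ be a Schwartz function. Define the fractional gradient of a (scalar- or vector-valued) function h by the principal value ∇^γ h(x) := μ_γ lim_{ε→0⁺} ∫_{|y−x|>ε} h(y) ⊗ (y−x) / |x−y|^{n+γ+1} dy, where μ_γ := 2^γ Γ((n+γ+1)/2)/(π^{n/2} Γ((1−γ)/2)), and set ν_γ := 2^γ Γ((n+γ)/2)/(π^{n/2} Γ(−γ/2)). Then for every x ∈ ℝ^n the second fractional gradient ∇^α(∇^β f)(x) exists and equals (−ν_{α+β}/(α+β)) · lim_{ε→0⁺} ∫_{|v|>ε} ( (f(x+v) − f(x)) / |v|^{n+α+β} ) ( ((n+α+β)/|v|²) v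 ⊗ v − Id ) dv, where Id is the identity endomorphism of ℝ^n. -/
open MeasureTheory Real Filter
open scoped Topology InnerProductSpace SchwartzMap

/-- The constant `μ_γ = 2^γ Γ((n+γ+1)/2)/(π^{n/2} Γ((1−γ)/2))`. -/
noncomputable def muConst (n : ℕ) (γ : ℝ) : ℝ :=
  2 ^ γ * Real.Gamma (((n : ℝ) + γ + 1) / 2) / (π ^ ((n : ℝ) / 2) * Real.Gamma ((1 - γ) / 2))

/-- The constant `ν_γ = 2^γ Γ((n+γ)/2)/(π^{n/2} Γ(−γ/2))`. -/
noncomputable def nuConst (n : ℕ) (γ : ℝ) : ℝ :=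
  2 ^ γ * Real.Gamma (((n : ℝ) + γ) / 2) / (π ^ ((n : ℝ) / 2) * Real.Gamma (-γ / 2))

section Gaussian

variable {V : Type*} [NormedAddCommGroup V] [InnerProductSpace ℝ V]

/-- The plane wave `w ↦ exp (i ⟪w, ξ⟫)`. -/
noncomputable def planeWave (w ξ : V) : ℂ := Complex.exp (Complex.I * (⟪w, ξ⟫_ℝ : ℝ))

lemma norm_planeWave (w ξ : V) : ‖planeWave w ξ‖ = 1 := by
  rw [planeWave, mul_comm, Complex.norm_exp_ofReal_mul_I]

lemma continuous_planeWave : Continuous fun p : V × V => planeWave p.1 p.2 := by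
  unfold planeWave
  fun_prop

lemma planeWave_add (x w ξ : V) : planeWave (x + w) ξ = planeWave x ξ * planeWave w ξ := by
  simp [planeWave, inner_add_left, mul_add, Complex.exp_add]

lemma planeWave_zero_right (w : V) : planeWave w (0 : V) = 1 := by
  simp [planeWave]

/-- The plane wave damped by a Gaussian weight. -/
noncomputable def gaussWave (t : ℝ) (ξ w : V) : ℂ :=
  planeWave w ξ * (Real.exp (-t * ‖w‖ ^ 2) : ℝ)

lemma continuous_gaussWave (t : ℝ) (ξ : V) : Continuous (gaussWave t ξ) := by
  unfold gaussWave planeWave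
  fun_prop

lemma norm_gaussWave (t : ℝ) (ξ w : V) : ‖gaussWave t ξ w‖ = Real.exp (-t * ‖w‖ ^ 2) := by
  rw [gaussWave, norm_mul, norm_planeWave, one_mul, Complex.norm_real, Real.norm_eq_abs,
    abs_of_pos (Real.exp_pos _)]

lemma hasLineDerivAt_gaussWave (t : ℝ) (ξ w v : V) :
    HasLineDerivAt ℝ (gaussWave t ξ)
      ((Complex.I * (⟪v, ξ⟫_ℝ : ℝ) - 2 * t * (⟪w, v⟫_ℝ : ℝ)) * gaussWave t ξ w) w v := by
  have key : ∀ s : ℝ, gaussWave t ξ (w + s • v) =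
      Complex.exp (Complex.I * ((⟪w, ξ⟫_ℝ : ℝ) + s * (⟪v, ξ⟫_ℝ : ℝ)) +
        (-t) * (‖w‖ ^ 2 + 2 * (s * (⟪w, v⟫_ℝ : ℝ)) + s ^ 2 * ‖v‖ ^ 2)) := by
    intro s
    rw [gaussWave, planeWave, Complex.ofReal_exp, ← Complex.exp_add]
    rw [norm_add_sq_real, inner_add_left, inner_smul_left, inner_smul_right, norm_smul, mul_pow,
      Real.norm_eq_abs, sq_abs]
    push_cast
    simp
  have h0 : gaussWave t ξ w = gaussWave t ξ (w + (0 : ℝ) • v) := by simp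
  unfold HasLineDerivAt
  rw [h0, key]
  simp_rw [key]
  have hs : HasDerivAt (fun s : ℝ => (s : ℂ)) 1 0 := Complex.ofRealCLM.hasDerivAt
  have h1 := ((((hs.mul_const ((⟪v, ξ⟫_ℝ : ℝ) : ℂ)).const_add ((⟪w, ξ⟫_ℝ : ℝ) : ℂ)).const_mul
    Complex.I).add ((((hs.mul_const ((⟪w, v⟫_ℝ : ℝ) : ℂ)).const_mul 2).const_add
      ((‖w‖ : ℂ) ^ 2) |>.add ((hs.pow 2).mul_const ((‖v‖ : ℂ) ^ 2))).const_mul (-t : ℂ))).cexp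
  refine HasDerivAt.congr_deriv h1 ?_
  simp
  ring

lemma norm_ofReal_inner_le (w b : V) : ‖((⟪w, b⟫_ℝ : ℝ) : ℂ)‖ ≤ ‖b‖ * ‖w‖ := by
  rw [Complex.norm_real, mul_comm]
  exact norm_inner_le_norm w b

lemma continuous_ofReal_inner (b : V) : Continuous fun w : V => ((⟪w, b⟫_ℝ : ℝ) : ℂ) := by
  fun_prop

variable [FiniteDimensional ℝ V] [MeasurableSpace V] [BorelSpace V]

lemma integrable_gaussWave {t : ℝ} (ht : 0 < t) (ξ : V) : Integrable (gaussWave t ξ) := by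
  have h := GaussianFourier.integrable_cexp_neg_mul_sq_norm_add (b := (t : ℂ)) (V := V)
    (by simpa using ht) Complex.I ξ
  refine h.congr (ae_of_all _ fun w => ?_)
  rw [gaussWave, planeWave, Complex.ofReal_exp, ← Complex.exp_add, real_inner_comm]
  push_cast
  ring_nf

lemma integrable_norm_pow_mul_exp {t : ℝ} (ht : 0 < t) (k : ℕ) :
    Integrable fun w : V => ‖w‖ ^ k * Real.exp (-t * ‖w‖ ^ 2) := by
  rcases subsingleton_or_nontrivial V with hV | hV
  · have := integrable_gaussWave ht (0 : V)
    have h2 := (this.norm).const_mul ((0 : ℝ) ^ k)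
    refine h2.congr (ae_of_all _ fun w => ?_)
    simp only [norm_gaussWave, Subsingleton.elim w 0, norm_zero]
  rw [integrable_fun_norm_addHaar volume (f := fun r => r ^ k * Real.exp (-t * r ^ 2))]
  have h := integrableOn_rpow_mul_exp_neg_mul_sq ht
    (s := ((Module.finrank ℝ V - 1 + k : ℕ) : ℝ)) (by
      have : (0 : ℝ) ≤ ((Module.finrank ℝ V - 1 + k : ℕ) : ℝ) := Nat.cast_nonneg _
      linarith)
  refine h.congr_fun (fun r _ => ?_) measurableSet_Ioi
  simp only [Real.rpow_natCast, pow_add, smul_eq_mul]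
  ring

lemma integrable_mul_gaussWave {t : ℝ} (ht : 0 < t) (ξ : V) {q : V → ℂ} (hq : Continuous q)
    {C : ℝ} {k : ℕ} (hb : ∀ w, ‖q w‖ ≤ C * ‖w‖ ^ k) :
    Integrable fun w => q w * gaussWave t ξ w := by
  refine ((integrable_norm_pow_mul_exp (V := V) ht k).const_mul C).mono'
    (hq.mul (continuous_gaussWave t ξ)).aestronglyMeasurable (ae_of_all _ fun w => ?_)
  rw [norm_mul, norm_gaussWave, ← mul_assoc]
  gcongr
  exact hb w

lemma integral_eq_zero_of_hasLineDerivAt {g g' : V → ℂ} {v : V} (hg : Integrable g)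
    (hg' : Integrable g') (h : ∀ w, HasLineDerivAt ℝ g (g' w) w v) : ∫ w, g' w = 0 := by
  have := integral_bilinear_hasLineDerivAt_right_eq_neg_left_of_integrable
    (μ := (volume : Measure V)) (f := fun _ => (1 : ℂ)) (f' := fun _ => 0) (g := g) (g' := g')
    (v := v) (B := ContinuousLinearMap.mul ℝ ℂ) (by simp) (by simpa using hg')
    (by simpa using hg)
    (fun w _ => by simpa [HasLineDerivAt] using hasDerivAt_const (0 : ℝ) (1 : ℂ))
    (fun w _ => h w)
  simpa using this

/-- The Fourier transform of the Gaussian `exp (-t ‖w‖ ^ 2)`. -/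
noncomputable def gaussHat (t : ℝ) (ξ : V) : ℝ :=
  (π / t) ^ ((Module.finrank ℝ V : ℝ) / 2) * Real.exp (-‖ξ‖ ^ 2 / (4 * t))

lemma integral_gaussWave {t : ℝ} (ht : 0 < t) (ξ : V) :
    ∫ w, gaussWave t ξ w = gaussHat t ξ := by
  have h := GaussianFourier.integral_cexp_neg_mul_sq_norm_add (b := (t : ℂ)) (V := V)
    (by simpa using ht) Complex.I ξ
  have h1 : ∫ w, gaussWave t ξ w =
      ∫ v : V, Complex.exp (-t * ‖v‖ ^ 2 + Complex.I * (⟪ξ, v⟫_ℝ : ℝ)) := by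
    refine integral_congr_ae (ae_of_all _ fun w => ?_)
    simp only
    rw [gaussWave, planeWave, Complex.ofReal_exp, ← Complex.exp_add, real_inner_comm]
    push_cast
    ring_nf
  rw [h1, h, gaussHat, Complex.ofReal_mul, Complex.ofReal_cpow (by positivity)]
  push_cast
  rw [Complex.I_sq]
  ring_nf

lemma integrable_inner_mul_gaussWave {t : ℝ} (ht : 0 < t) (ξ b : V) :
    Integrable fun w : V => ((⟪w, b⟫_ℝ : ℝ) : ℂ) * gaussWave t ξ w :=
  integrable_mul_gaussWave ht ξ (continuous_ofReal_inner b) (C := ‖b‖) (k := 1)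
    (fun w => by simpa using norm_ofReal_inner_le w b)

lemma integrable_inner_mul_inner_mul_gaussWave {t : ℝ} (ht : 0 < t) (ξ a b : V) :
    Integrable fun w : V => (((⟪w, a⟫_ℝ : ℝ) : ℂ) * ((⟪w, b⟫_ℝ : ℝ) : ℂ)) * gaussWave t ξ w :=
  integrable_mul_gaussWave ht ξ ((continuous_ofReal_inner a).mul (continuous_ofReal_inner b))
    (C := ‖a‖ * ‖b‖) (k := 2) (fun w => by
      rw [norm_mul]
      calc _ ≤ (‖a‖ * ‖w‖) * (‖b‖ * ‖w‖) := by
            gcongr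
            · exact norm_ofReal_inner_le w a
            · exact norm_ofReal_inner_le w b
        _ = _ := by ring)

lemma integral_inner_mul_gaussWave {t : ℝ} (ht : 0 < t) (ξ b : V) :
    ∫ w : V, ((⟪w, b⟫_ℝ : ℝ) : ℂ) * gaussWave t ξ w =
      Complex.I * (⟪ξ, b⟫_ℝ : ℝ) / (2 * t) * gaussHat t ξ := by
  have hi := integrable_gaussWave ht ξ
  have hi1 := integrable_inner_mul_gaussWave ht ξ b
  have h0 := integral_eq_zero_of_hasLineDerivAt hi
    (((hi.const_mul (Complex.I * (⟪b, ξ⟫_ℝ : ℝ))).sub (hi1.const_mul (2 * t))).congr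
      (ae_of_all _ fun w => by simp only [Pi.sub_apply]; ring))
    (fun w => hasLineDerivAt_gaussWave t ξ w b)
  have h1 : ∫ w : V, (Complex.I * (⟪b, ξ⟫_ℝ : ℝ) - 2 * t * (⟪w, b⟫_ℝ : ℝ)) * gaussWave t ξ w =
      Complex.I * (⟪b, ξ⟫_ℝ : ℝ) * gaussHat t ξ -
        2 * t * ∫ w : V, ((⟪w, b⟫_ℝ : ℝ) : ℂ) * gaussWave t ξ w := by
    rw [← integral_gaussWave ht, ← integral_const_mul, ← integral_const_mul,
      ← integral_sub (hi.const_mul _) (hi1.const_mul _)]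
    congr 1; ext w; ring
  rw [h1] at h0
  have ht' : (t : ℂ) ≠ 0 := by exact_mod_cast ht.ne'
  rw [real_inner_comm b ξ]
  field_simp
  linear_combination -h0

lemma integral_hessian_mul_gaussWave {t : ℝ} (ht : 0 < t) (ξ a b : V) :
    ∫ w : V, (2 * t * (((⟪w, a⟫_ℝ : ℝ) : ℂ) * ((⟪w, b⟫_ℝ : ℝ) : ℂ)) - (⟪a, b⟫_ℝ : ℝ)) *
        gaussWave t ξ w =
      -((⟪ξ, a⟫_ℝ : ℝ) * (⟪ξ, b⟫_ℝ : ℝ)) / (2 * t) * gaussHat t ξ := by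
  have hi := integrable_gaussWave ht ξ
  have hi1 := integrable_inner_mul_gaussWave ht ξ b
  have hi2 := integrable_inner_mul_inner_mul_gaussWave ht ξ a b
  have hd : ∀ w, HasLineDerivAt ℝ (fun w : V => ((⟪w, b⟫_ℝ : ℝ) : ℂ) * gaussWave t ξ w)
      (((⟪a, b⟫_ℝ : ℝ) : ℂ) * gaussWave t ξ w + ((⟪w, b⟫_ℝ : ℝ) : ℂ) *
        ((Complex.I * (⟪a, ξ⟫_ℝ : ℝ) - 2 * t * (⟪w, a⟫_ℝ : ℝ)) * gaussWave t ξ w)) w a := by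
    intro w
    have hs : HasDerivAt (fun s : ℝ => (s : ℂ)) 1 0 := Complex.ofRealCLM.hasDerivAt
    have hl : HasDerivAt (fun s : ℝ => ((⟪w + s • a, b⟫_ℝ : ℝ) : ℂ)) ((⟪a, b⟫_ℝ : ℝ) : ℂ) 0 := by
      have h1 := (hs.mul_const ((⟪a, b⟫_ℝ : ℝ) : ℂ)).const_add ((⟪w, b⟫_ℝ : ℝ) : ℂ)
      refine HasDerivAt.congr_deriv (h1.congr_of_eventuallyEq (.of_forall fun s => ?_)) (one_mul _)
      simp [inner_add_left, inner_smul_left]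
    have := hl.mul (hasLineDerivAt_gaussWave t ξ w a)
    refine HasDerivAt.congr_deriv this ?_
    simp
  have h0 := integral_eq_zero_of_hasLineDerivAt hi1
    ((((hi.const_mul ((⟪a, b⟫_ℝ : ℝ) : ℂ)).add
      (hi1.const_mul (Complex.I * (⟪a, ξ⟫_ℝ : ℝ)))).sub (hi2.const_mul (2 * t))).congr
      (ae_of_all _ fun w => by simp only [Pi.sub_apply, Pi.add_apply]; ring)) hd
  have h1 := integral_inner_mul_gaussWave ht ξ b
  have h2 : ∫ w : V, (2 * t * (((⟪w, a⟫_ℝ : ℝ) : ℂ) * ((⟪w, b⟫_ℝ : ℝ) : ℂ)) - (⟪a, b⟫_ℝ : ℝ)) *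
        gaussWave t ξ w = Complex.I * (⟪a, ξ⟫_ℝ : ℝ) *
          (∫ w : V, ((⟪w, b⟫_ℝ : ℝ) : ℂ) * gaussWave t ξ w) -
        ∫ w : V, (((⟪a, b⟫_ℝ : ℝ) : ℂ) * gaussWave t ξ w + ((⟪w, b⟫_ℝ : ℝ) : ℂ) *
        ((Complex.I * (⟪a, ξ⟫_ℝ : ℝ) - 2 * t * (⟪w, a⟫_ℝ : ℝ)) * gaussWave t ξ w)) := by
    rw [← integral_const_mul, ← integral_sub (hi1.const_mul _)]
    · congr 1; ext w; ring
    · exact (((hi.const_mul ((⟪a, b⟫_ℝ : ℝ) : ℂ)).add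
        (hi1.const_mul (Complex.I * (⟪a, ξ⟫_ℝ : ℝ)))).sub (hi2.const_mul (2 * t))).congr
        (ae_of_all _ fun w => by simp only [Pi.sub_apply, Pi.add_apply]; ring)
  rw [h2, h0, h1, real_inner_comm ξ a]
  linear_combination ((⟪ξ, a⟫_ℝ : ℝ) : ℂ) * (⟪ξ, b⟫_ℝ : ℝ) / (2 * t) * gaussHat t ξ * Complex.I_sq

end Gaussian

section Multipliers

variable {V : Type*} [NormedAddCommGroup V] [InnerProductSpace ℝ V]

/-- The even part of the plane wave in `w`, minus one, i.e. `cos ⟪w, ξ⟫ - 1`. -/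
noncomputable def evenWave (w ξ : V) : ℂ := (planeWave w ξ + planeWave w (-ξ)) / 2 - 1

lemma evenWave_eq_ofReal (w ξ : V) : evenWave w ξ = ((Real.cos ⟪w, ξ⟫_ℝ - 1 : ℝ) : ℂ) := by
  rw [evenWave, planeWave, planeWave]
  push_cast
  rw [Complex.cos, inner_neg_right]
  push_cast
  ring_nf

lemma le_min_one_norm_pow_mul {W : Type*} [SeminormedAddCommGroup W] {x : ℝ} {p : ℕ}
    {w ξ : W} (h1 : x ≤ 2) (h2 : x ≤ 2 * ‖w‖ ^ p * (1 + ‖ξ‖) ^ 2) :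
    x ≤ 2 * min 1 (‖w‖ ^ p) * (1 + ‖ξ‖) ^ 2 := by
  have h3 : 1 ≤ (1 + ‖ξ‖) ^ 2 := one_le_pow₀ (by linarith [norm_nonneg ξ])
  rcases min_choice 1 (‖w‖ ^ p) with h | h <;> rw [h]
  · linarith
  · exact h2

lemma norm_planeWave_sub_one_le (w ξ : V) :
    ‖planeWave w ξ - 1‖ ≤ 2 * min 1 (‖w‖ ^ 1) * (1 + ‖ξ‖) ^ 2 := by
  apply le_min_one_norm_pow_mul
  · calc _ ≤ ‖planeWave w ξ‖ + ‖(1 : ℂ)‖ := norm_sub_le _ _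
      _ = 2 := by rw [norm_planeWave, norm_one]; norm_num
  · have h := Real.norm_exp_I_mul_ofReal_sub_one_le (x := ⟪w, ξ⟫_ℝ)
    have h2 := norm_inner_le_norm (𝕜 := ℝ) w ξ
    have h3 : ‖ξ‖ ≤ 2 * (1 + ‖ξ‖) ^ 2 := by nlinarith [norm_nonneg ξ]
    calc _ ≤ ‖w‖ * ‖ξ‖ := h.trans h2
      _ ≤ ‖w‖ * (2 * (1 + ‖ξ‖) ^ 2) := by gcongr
      _ = _ := by ring

lemma norm_evenWave_le (w ξ : V) :
    ‖evenWave w ξ‖ ≤ 2 * min 1 (‖w‖ ^ 2) * (1 + ‖ξ‖) ^ 2 := by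
  rw [evenWave_eq_ofReal, Complex.norm_real, Real.norm_eq_abs, abs_of_nonpos
    (by linarith [Real.cos_le_one ⟪w, ξ⟫_ℝ])]
  apply le_min_one_norm_pow_mul
  · linarith [Real.neg_one_le_cos ⟪w, ξ⟫_ℝ]
  · have h1 := Real.one_sub_sq_div_two_le_cos (x := ⟪w, ξ⟫_ℝ)
    have h2 : ⟪w, ξ⟫_ℝ ^ 2 ≤ (‖w‖ * ‖ξ‖) ^ 2 :=
      sq_le_sq' (neg_le_of_abs_le (abs_real_inner_le_norm w ξ)) (real_inner_le_norm w ξ)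
    have h3 : ‖ξ‖ ^ 2 ≤ (1 + ‖ξ‖) ^ 2 := by nlinarith [norm_nonneg ξ]
    calc _ ≤ ‖w‖ ^ 2 * ‖ξ‖ ^ 2 := by nlinarith [sq_nonneg ⟪w, ξ⟫_ℝ]
      _ ≤ ‖w‖ ^ 2 * (2 * (1 + ‖ξ‖) ^ 2) := by gcongr; linarith [sq_nonneg (1 + ‖ξ‖)]
      _ = _ := by ring

/-- The radial majorant of the truncated kernels. -/
noncomputable def radialMajorant (γ : ℝ) (p : ℕ) (w : V) : ℝ :=
  (‖w‖ ^ ((Module.finrank ℝ V : ℝ) + γ))⁻¹ * min 1 (‖w‖ ^ p)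

lemma continuous_planeWave_left (ξ : V) : Continuous fun w : V => planeWave w ξ := by
  unfold planeWave
  fun_prop

lemma continuous_evenWave_left (ξ : V) : Continuous fun w : V => evenWave w ξ := by
  unfold evenWave planeWave
  fun_prop

lemma gaussHat_neg (t : ℝ) (ξ : V) : gaussHat t (-ξ) = gaussHat t ξ := by
  simp [gaussHat]

/-- The constant in the Fourier multipliers of the fractional kernels. -/
noncomputable def multiplierConst (d : ℕ) (q : ℝ) : ℝ :=
  π ^ ((d : ℝ) / 2) * 2 ^ (1 - q) * Real.Gamma (1 - q / 2) / Real.Gamma (((d : ℝ) + q) / 2)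

lemma integral_rpow_mul_gaussHat {q : ℝ} (hq : q < 2) {ξ : V} (hξ : ξ ≠ 0) :
    ∫ t in Set.Ioi (0 : ℝ), t ^ (((Module.finrank ℝ V : ℝ) + q) / 2 - 1) *
        (1 / (2 * t) * gaussHat t ξ) =
      π ^ ((Module.finrank ℝ V : ℝ) / 2) * 2 ^ (1 - q) * Real.Gamma (1 - q / 2) *
        ‖ξ‖ ^ (q - 2) := by
  have hn : 0 < ‖ξ‖ := norm_pos_iff.mpr hξ
  have h := integral_comp_rpow_Ioi (fun u : ℝ => π ^ ((Module.finrank ℝ V : ℝ) / 2) / 2 *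
    (u ^ ((1 - q / 2) - 1) * Real.exp (-(‖ξ‖ ^ 2 / 4 * u)))) (p := -1) (by norm_num)
  rw [integral_const_mul, Real.integral_rpow_mul_exp_neg_mul_Ioi (by linarith) (by positivity)] at h
  have h2 : ∫ t in Set.Ioi (0 : ℝ), t ^ (((Module.finrank ℝ V : ℝ) + q) / 2 - 1) *
        (1 / (2 * t) * gaussHat t ξ) = π ^ ((Module.finrank ℝ V : ℝ) / 2) / 2 *
          ((1 / (‖ξ‖ ^ 2 / 4)) ^ (1 - q / 2) * Real.Gamma (1 - q / 2)) := by
    refine Eq.trans (setIntegral_congr_fun measurableSet_Ioi fun t ht => ?_) h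
    have ht : (0 : ℝ) < t := ht
    simp only [gaussHat, smul_eq_mul]
    have e1 : -‖ξ‖ ^ 2 / (4 * t) = -(‖ξ‖ ^ 2 / 4 * t ^ (-1 : ℝ)) := by
      rw [Real.rpow_neg_one]; field_simp
    have e2 : t ^ (((Module.finrank ℝ V : ℝ) + q) / 2 - 1) =
        t ^ ((Module.finrank ℝ V : ℝ) / 2) * t ^ (q / 2) * t⁻¹ := by
      rw [← Real.rpow_neg_one t, ← Real.rpow_add ht, ← Real.rpow_add ht]; ring_nf
    have e3 : (t ^ (-1 : ℝ)) ^ ((1 - q / 2) - 1) = t ^ (q / 2) := by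
      rw [← Real.rpow_mul ht.le]; ring_nf
    have e4 : t ^ (-1 - 1 : ℝ) = t⁻¹ * t⁻¹ := by
      rw [← Real.rpow_neg_one t, ← Real.rpow_add ht]; ring_nf
    rw [e1, e2, e3, e4, Real.div_rpow Real.pi_pos.le ht.le]
    have : t ^ ((Module.finrank ℝ V : ℝ) / 2) ≠ 0 := (Real.rpow_pos_of_pos ht _).ne'
    rw [abs_neg, abs_one]
    field_simp
  rw [h2]
  have e5 : (1 / (‖ξ‖ ^ 2 / 4)) ^ (1 - q / 2) = 2 * 2 ^ (1 - q) * ‖ξ‖ ^ (q - 2) := by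
    have : 1 / (‖ξ‖ ^ 2 / 4) = (2 * ‖ξ‖⁻¹) ^ (2 : ℝ) := by
      rw [Real.rpow_two]; field_simp; norm_num
    rw [this, ← Real.rpow_mul (by positivity), Real.mul_rpow (by norm_num) (by positivity),
      Real.inv_rpow hn.le, ← Real.rpow_neg hn.le, ← Real.rpow_one_add' (by norm_num) (by linarith)]
    ring_nf
  rw [e5]
  ring

lemma Gamma_mul_multiplierConst {d : ℕ} {q : ℝ} (hq : 0 < q) :
    Real.Gamma (((d : ℝ) + q) / 2) * multiplierConst d q =
      π ^ ((d : ℝ) / 2) * 2 ^ (1 - q) * Real.Gamma (1 - q / 2) := by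
  have : Real.Gamma (((d : ℝ) + q) / 2) ≠ 0 := (Real.Gamma_pos_of_pos (by positivity)).ne'
  rw [multiplierConst]
  field_simp

variable [FiniteDimensional ℝ V] [MeasurableSpace V] [BorelSpace V]

lemma integrable_radialMajorant [Nontrivial V] {γ : ℝ} {p : ℕ} (h0 : 0 < γ) (hp : γ < p) :
    Integrable (radialMajorant γ p : V → ℝ) := by
  unfold radialMajorant
  rw [integrable_fun_norm_addHaar volume
    (f := fun r => (r ^ ((Module.finrank ℝ V : ℝ) + γ))⁻¹ * min 1 (r ^ p))]
  have hd : 0 < Module.finrank ℝ V := Module.finrank_pos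
  have key : ∀ r : ℝ, 0 < r → r ^ (Module.finrank ℝ V - 1) •
      ((r ^ ((Module.finrank ℝ V : ℝ) + γ))⁻¹ * min 1 (r ^ p)) = r ^ (-1 - γ) * min 1 (r ^ p) := by
    intro r hr
    rw [smul_eq_mul, ← mul_assoc, ← Real.rpow_natCast, ← Real.rpow_neg hr.le, ← Real.rpow_add hr,
      Nat.cast_sub hd]
    congr 2
    push_cast
    ring
  rw [← Set.Ioc_union_Ioi_eq_Ioi (zero_le_one' ℝ)]
  refine IntegrableOn.union ?_ ?_
  · have h : IntegrableOn (fun r : ℝ => r ^ (-1 - γ + p)) (Set.Ioc 0 1) := by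
      rw [integrableOn_Ioc_iff_integrableOn_Ioo,
        intervalIntegral.integrableOn_Ioo_rpow_iff one_pos]
      linarith
    refine h.congr_fun (fun r hr => ?_) measurableSet_Ioc
    simp only
    rw [key r hr.1, min_eq_right (pow_le_one₀ hr.1.le hr.2), Real.rpow_add hr.1, Real.rpow_natCast]
  · refine (integrableOn_Ioi_rpow_of_lt (a := -1 - γ) (by linarith) one_pos).congr_fun
      (fun r hr => ?_) measurableSet_Ioi
    simp only
    have hr1 : (1 : ℝ) < r := hr
    rw [key r (by linarith), min_eq_left (one_le_pow₀ hr1.le), mul_one]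

section Subordination

variable [Nontrivial V] {Q : V → ℂ} {s : ℝ}

lemma integrable_subordination (hQ : Continuous Q) (hs : 0 < s)
    (hi : Integrable fun w => Q w * (((‖w‖ ^ (2 * s))⁻¹ : ℝ) : ℂ)) :
    Integrable (Function.uncurry fun (w : V) (t : ℝ) =>
      Q w * ((t ^ (s - 1) * Real.exp (-(‖w‖ ^ 2 * t)) : ℝ) : ℂ))
      (volume.prod (volume.restrict (Set.Ioi 0))) := by
  have hne : ∀ᵐ w : V, w ≠ 0 := by simp [ae_iff, measure_singleton]
  rw [integrable_prod_iff]
  · constructor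
    · filter_upwards [hne] with w hw
      simp only [Function.uncurry_apply_pair]
      have h := integrableOn_rpow_mul_exp_neg_mul_rpow (s := s - 1) (p := 1) (b := ‖w‖ ^ 2)
        (by linarith) one_pos (by positivity)
      have h' : IntegrableOn (fun t : ℝ => t ^ (s - 1) * Real.exp (-(‖w‖ ^ 2 * t)))
          (Set.Ioi 0) := by
        simpa using h
      exact Integrable.const_mul (Integrable.ofReal h') _
    · refine (hi.norm.const_mul (Real.Gamma s)).congr ?_
      filter_upwards [hne] with w hw
      simp only [Function.uncurry_apply_pair, norm_mul]
      rw [integral_const_mul]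
      have h1 : ∫ t in Set.Ioi (0 : ℝ), ‖((t ^ (s - 1) * Real.exp (-(‖w‖ ^ 2 * t)) : ℝ) : ℂ)‖ =
          ∫ t in Set.Ioi (0 : ℝ), t ^ (s - 1) * Real.exp (-(‖w‖ ^ 2 * t)) := by
        refine setIntegral_congr_fun measurableSet_Ioi fun t ht => ?_
        have : (0 : ℝ) < t := ht
        rw [Complex.norm_real, Real.norm_of_nonneg (by positivity)]
      rw [h1, Real.integral_rpow_mul_exp_neg_mul_Ioi hs (by positivity), Complex.norm_real,
        Real.norm_of_nonneg (by positivity), one_div, Real.inv_rpow (by positivity),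
        Real.rpow_mul (norm_nonneg w), Real.rpow_ofNat]
      ring
  · refine Measurable.aestronglyMeasurable ?_
    have := hQ.measurable
    unfold Function.uncurry
    fun_prop

lemma integrableOn_subordination (hQ : Continuous Q) (hs : 0 < s)
    (hi : Integrable fun w => Q w * (((‖w‖ ^ (2 * s))⁻¹ : ℝ) : ℂ)) :
    IntegrableOn (fun t : ℝ => ((t ^ (s - 1) : ℝ) : ℂ) *
      ∫ w, Q w * ((Real.exp (-t * ‖w‖ ^ 2) : ℝ) : ℂ)) (Set.Ioi 0) := by
  refine (integrable_subordination hQ hs hi).integral_prod_right.congr (ae_of_all _ fun t => ?_)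
  simp only [Function.uncurry_apply_pair]
  rw [← integral_const_mul]
  congr 1; ext w
  push_cast
  ring_nf

lemma integral_subordination (hQ : Continuous Q) (hs : 0 < s)
    (hi : Integrable fun w => Q w * (((‖w‖ ^ (2 * s))⁻¹ : ℝ) : ℂ)) :
    Real.Gamma s * ∫ w, Q w * (((‖w‖ ^ (2 * s))⁻¹ : ℝ) : ℂ) =
      ∫ t in Set.Ioi (0 : ℝ), ((t ^ (s - 1) : ℝ) : ℂ) *
        ∫ w, Q w * ((Real.exp (-t * ‖w‖ ^ 2) : ℝ) : ℂ) := by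
  have hne : ∀ᵐ w : V, w ≠ 0 := by simp [ae_iff, measure_singleton]
  have h1 : ∫ t in Set.Ioi (0 : ℝ), ((t ^ (s - 1) : ℝ) : ℂ) *
        ∫ w, Q w * ((Real.exp (-t * ‖w‖ ^ 2) : ℝ) : ℂ) =
      ∫ t in Set.Ioi (0 : ℝ), ∫ w,
        Q w * ((t ^ (s - 1) * Real.exp (-(‖w‖ ^ 2 * t)) : ℝ) : ℂ) := by
    congr 1; ext t
    rw [← integral_const_mul]
    congr 1; ext w
    push_cast
    ring_nf
  rw [h1, ← integral_integral_swap (integrable_subordination hQ hs hi), ← integral_const_mul]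
  refine integral_congr_ae ?_
  filter_upwards [hne] with w hw
  rw [integral_const_mul, integral_complex_ofReal,
    Real.integral_rpow_mul_exp_neg_mul_Ioi hs (by positivity), one_div,
    Real.inv_rpow (by positivity), Real.rpow_mul (norm_nonneg w), Real.rpow_ofNat]
  push_cast
  ring

end Subordination

lemma integral_mul_evenWave_mul_exp {t : ℝ} (ξ : V) {P : V → ℂ}
    (hP : ∀ η : V, Integrable fun w => P w * gaussWave t η w) :
    ∫ w, (P w * evenWave w ξ) * ((Real.exp (-t * ‖w‖ ^ 2) : ℝ) : ℂ) =
      ((∫ w, P w * gaussWave t ξ w) + ∫ w, P w * gaussWave t (-ξ) w) / 2 -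
        ∫ w, P w * gaussWave t 0 w := by
  have h : Integrable fun w => (P w * gaussWave t ξ w + P w * gaussWave t (-ξ) w) / 2 :=
    ((hP ξ).add (hP (-ξ))).div_const 2
  rw [← integral_add (hP ξ) (hP (-ξ)), ← integral_div, ← integral_sub h (hP 0)]
  congr 1; ext w
  rw [gaussWave, gaussWave, gaussWave, planeWave_zero_right, evenWave]
  ring

variable [Nontrivial V]

/-- The Fourier multiplier of the kernel `⟪w, b⟫ / ‖w‖ ^ (d + q)`. -/
lemma integral_inner_kernel {q : ℝ} (hq0 : 0 < q) (hq : q < 2) (ξ b : V)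
    (hi : Integrable fun w : V => (((⟪w, b⟫_ℝ : ℝ) : ℂ) * (planeWave w ξ - 1)) *
      (((‖w‖ ^ ((Module.finrank ℝ V : ℝ) + q))⁻¹ : ℝ) : ℂ)) :
    ∫ w : V, (((⟪w, b⟫_ℝ : ℝ) : ℂ) * (planeWave w ξ - 1)) *
      (((‖w‖ ^ ((Module.finrank ℝ V : ℝ) + q))⁻¹ : ℝ) : ℂ) =
    Complex.I * (⟪ξ, b⟫_ℝ * ‖ξ‖ ^ (q - 2) * multiplierConst (Module.finrank ℝ V) q : ℝ) := by
  rcases eq_or_ne ξ 0 with rfl | hξ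
  · simp [planeWave_zero_right]
  set s : ℝ := ((Module.finrank ℝ V : ℝ) + q) / 2 with hs
  have hs0 : 0 < s := by positivity
  have e : (Module.finrank ℝ V : ℝ) + q = 2 * s := by rw [hs]; ring
  have hG : (Real.Gamma s : ℂ) ≠ 0 := by exact_mod_cast (Real.Gamma_pos_of_pos hs0).ne'
  rw [e] at hi ⊢
  apply mul_left_cancel₀ hG
  have hc : Continuous fun w : V => ((⟪w, b⟫_ℝ : ℝ) : ℂ) * (planeWave w ξ - 1) :=
    (continuous_ofReal_inner b).mul ((continuous_planeWave_left ξ).sub continuous_const)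
  rw [integral_subordination hc hs0 hi]
  have h1 : ∀ t ∈ Set.Ioi (0 : ℝ), ((t ^ (s - 1) : ℝ) : ℂ) *
      ∫ w : V, (((⟪w, b⟫_ℝ : ℝ) : ℂ) * (planeWave w ξ - 1)) *
        ((Real.exp (-t * ‖w‖ ^ 2) : ℝ) : ℂ) =
      (Complex.I * (⟪ξ, b⟫_ℝ : ℝ)) * ((t ^ (s - 1) * (1 / (2 * t) * gaussHat t ξ) : ℝ) : ℂ) := by
    intro t ht
    have ht : 0 < t := ht
    have h2 : ∫ w : V, (((⟪w, b⟫_ℝ : ℝ) : ℂ) * (planeWave w ξ - 1)) *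
        ((Real.exp (-t * ‖w‖ ^ 2) : ℝ) : ℂ) =
        (∫ w : V, ((⟪w, b⟫_ℝ : ℝ) : ℂ) * gaussWave t ξ w) -
          ∫ w : V, ((⟪w, b⟫_ℝ : ℝ) : ℂ) * gaussWave t 0 w := by
      rw [← integral_sub (integrable_inner_mul_gaussWave ht ξ b)
        (integrable_inner_mul_gaussWave ht 0 b)]
      congr 1; ext w
      rw [gaussWave, gaussWave, planeWave_zero_right]
      ring
    rw [h2, integral_inner_mul_gaussWave ht, integral_inner_mul_gaussWave ht, inner_zero_left]
    push_cast
    ring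
  rw [setIntegral_congr_fun measurableSet_Ioi h1, integral_const_mul, integral_complex_ofReal, hs,
    integral_rpow_mul_gaussHat hq hξ, ← Gamma_mul_multiplierConst hq0]
  push_cast
  ring

/-- The Fourier multiplier of the kernel
`((d + q) ⟪w, a⟫ ⟪w, b⟫ / ‖w‖ ^ 2 - ⟪a, b⟫) / ‖w‖ ^ (d + q)`. -/
lemma integral_hessian_kernel {q : ℝ} (hq0 : 0 < q) (hq : q < 2) (ξ a b : V)
    (hi1 : Integrable fun w : V => ((((⟪w, a⟫_ℝ : ℝ) : ℂ) * ((⟪w, b⟫_ℝ : ℝ) : ℂ)) * evenWave w ξ) *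
      (((‖w‖ ^ ((Module.finrank ℝ V : ℝ) + q + 2))⁻¹ : ℝ) : ℂ))
    (hi2 : Integrable fun w : V => (((⟪a, b⟫_ℝ : ℝ) : ℂ) * evenWave w ξ) *
      (((‖w‖ ^ ((Module.finrank ℝ V : ℝ) + q))⁻¹ : ℝ) : ℂ)) :
    (((Module.finrank ℝ V : ℝ) + q : ℝ) : ℂ) * (∫ w : V,
      ((((⟪w, a⟫_ℝ : ℝ) : ℂ) * ((⟪w, b⟫_ℝ : ℝ) : ℂ)) * evenWave w ξ) *
        (((‖w‖ ^ ((Module.finrank ℝ V : ℝ) + q + 2))⁻¹ : ℝ) : ℂ)) -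
      ∫ w : V, (((⟪a, b⟫_ℝ : ℝ) : ℂ) * evenWave w ξ) *
        (((‖w‖ ^ ((Module.finrank ℝ V : ℝ) + q))⁻¹ : ℝ) : ℂ) =
    ((-(⟪ξ, a⟫_ℝ * ⟪ξ, b⟫_ℝ * ‖ξ‖ ^ (q - 2) *
      multiplierConst (Module.finrank ℝ V) q) : ℝ) : ℂ) := by
  rcases eq_or_ne ξ 0 with rfl | hξ
  · simp [evenWave, planeWave_zero_right]
  set s : ℝ := ((Module.finrank ℝ V : ℝ) + q) / 2 with hs
  have hs0 : 0 < s := by positivity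
  have e : (Module.finrank ℝ V : ℝ) + q = 2 * s := by rw [hs]; ring
  have e' : (Module.finrank ℝ V : ℝ) + q + 2 = 2 * (s + 1) := by rw [hs]; ring
  have hG : (Real.Gamma s : ℂ) ≠ 0 := by exact_mod_cast (Real.Gamma_pos_of_pos hs0).ne'
  have hs1 : 0 < s + 1 := by linarith
  have hc1 : Continuous fun w : V =>
      ((((⟪w, a⟫_ℝ : ℝ) : ℂ) * ((⟪w, b⟫_ℝ : ℝ) : ℂ)) * evenWave w ξ) :=
    ((continuous_ofReal_inner a).mul (continuous_ofReal_inner b)).mul (continuous_evenWave_left ξ)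
  have hc2 : Continuous fun w : V => (((⟪a, b⟫_ℝ : ℝ) : ℂ) * evenWave w ξ) :=
    continuous_const.mul (continuous_evenWave_left ξ)
  rw [e'] at hi1 ⊢
  rw [e] at hi2 ⊢
  apply mul_left_cancel₀ hG
  have j1 := integral_subordination hc1 hs1 hi1
  have j2 := integral_subordination hc2 hs0 hi2
  have k1 := integrableOn_subordination hc1 hs1 hi1
  have k2 := integrableOn_subordination hc2 hs0 hi2
  rw [Real.Gamma_add_one hs0.ne'] at j1
  have h1 : ∀ t ∈ Set.Ioi (0 : ℝ), 2 * (((t ^ (s + 1 - 1) : ℝ) : ℂ) *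
      ∫ w : V, ((((⟪w, a⟫_ℝ : ℝ) : ℂ) * ((⟪w, b⟫_ℝ : ℝ) : ℂ)) * evenWave w ξ) *
        ((Real.exp (-t * ‖w‖ ^ 2) : ℝ) : ℂ)) - ((t ^ (s - 1) : ℝ) : ℂ) *
      (∫ w : V, (((⟪a, b⟫_ℝ : ℝ) : ℂ) * evenWave w ξ) * ((Real.exp (-t * ‖w‖ ^ 2) : ℝ) : ℂ)) =
      (-((⟪ξ, a⟫_ℝ : ℝ) * (⟪ξ, b⟫_ℝ : ℝ)) : ℂ) *
        ((t ^ (s - 1) * (1 / (2 * t) * gaussHat t ξ) : ℝ) : ℂ) := by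
    intro t ht
    have ht : 0 < t := ht
    have hA := fun η : V => integrable_inner_mul_inner_mul_gaussWave ht η a b
    have hB := fun η : V => (integrable_gaussWave ht η).const_mul ((⟪a, b⟫_ℝ : ℝ) : ℂ)
    have hH : ∀ η : V, 2 * t * (∫ w : V, (((⟪w, a⟫_ℝ : ℝ) : ℂ) * ((⟪w, b⟫_ℝ : ℝ) : ℂ)) *
        gaussWave t η w) - (∫ w : V, ((⟪a, b⟫_ℝ : ℝ) : ℂ) * gaussWave t η w) =
        -((⟪η, a⟫_ℝ : ℝ) * (⟪η, b⟫_ℝ : ℝ)) / (2 * t) * gaussHat t η := by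
      intro η
      rw [← integral_hessian_mul_gaussWave ht, ← integral_const_mul,
        ← integral_sub ((hA η).const_mul _) (hB η)]
      congr 1; ext w; ring
    have e3 : t ^ (s + 1 - 1) = t ^ (s - 1) * t := by
      rw [← Real.rpow_add_one ht.ne']; ring_nf
    rw [integral_mul_evenWave_mul_exp ξ hA, integral_mul_evenWave_mul_exp ξ hB, e3]
    have i1 := hH ξ
    have i2 := hH (-ξ)
    have i3 := hH 0
    rw [gaussHat_neg] at i2
    simp only [inner_neg_left, inner_zero_left] at i2 i3
    push_cast at i1 i2 i3 ⊢
    linear_combination ((t ^ (s - 1) : ℝ) : ℂ) * ((i1 + i2) / 2 - i3)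
  have h3 : ∫ t in Set.Ioi (0 : ℝ), (2 * (((t ^ (s + 1 - 1) : ℝ) : ℂ) *
      ∫ w : V, ((((⟪w, a⟫_ℝ : ℝ) : ℂ) * ((⟪w, b⟫_ℝ : ℝ) : ℂ)) * evenWave w ξ) *
        ((Real.exp (-t * ‖w‖ ^ 2) : ℝ) : ℂ)) - ((t ^ (s - 1) : ℝ) : ℂ) *
      (∫ w : V, (((⟪a, b⟫_ℝ : ℝ) : ℂ) * evenWave w ξ) * ((Real.exp (-t * ‖w‖ ^ 2) : ℝ) : ℂ))) =
      (-((⟪ξ, a⟫_ℝ : ℝ) * (⟪ξ, b⟫_ℝ : ℝ)) : ℂ) *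
        ((Real.Gamma s * multiplierConst (Module.finrank ℝ V) q * ‖ξ‖ ^ (q - 2) : ℝ) : ℂ) := by
    rw [setIntegral_congr_fun measurableSet_Ioi h1, integral_const_mul, integral_complex_ofReal, hs,
      integral_rpow_mul_gaussHat hq hξ, ← Gamma_mul_multiplierConst hq0]
  rw [integral_sub (k1.const_mul 2) k2, integral_const_mul, ← j1, ← j2] at h3
  push_cast at h3 ⊢
  linear_combination h3

end Multipliers

section TruncatedKernel

variable {V : Type*} [NormedAddCommGroup V] [InnerProductSpace ℝ V] [FiniteDimensional ℝ V]
  [MeasurableSpace V] [BorelSpace V] {ψ : V → ℂ} {h : V → ℝ}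

lemma integrable_mul_planeWave (hψ : Integrable ψ) (x : V) :
    Integrable fun ξ => ψ ξ * planeWave x ξ := by
  refine hψ.mul_bdd (c := 1) ?_ (ae_of_all _ fun ξ => (norm_planeWave x ξ).le)
  exact (continuous_planeWave.comp
    (by fun_prop : Continuous fun ξ : V => (x, ξ))).aestronglyMeasurable

lemma continuous_of_eq_integral_planeWave (hψ : Integrable ψ)
    (hh : ∀ x, (h x : ℂ) = ∫ ξ, ψ ξ * planeWave x ξ) : Continuous h := by
  have h1 : Continuous fun x : V => ∫ ξ, ψ ξ * planeWave x ξ := by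
    refine continuous_of_dominated (bound := fun ξ => ‖ψ ξ‖)
      (fun x => (integrable_mul_planeWave hψ x).aestronglyMeasurable)
      (fun x => ae_of_all _ fun ξ => by rw [norm_mul, norm_planeWave, mul_one]) hψ.norm
      (ae_of_all _ fun ξ => ?_)
    exact continuous_const.mul
      (continuous_planeWave.comp (by fun_prop : Continuous fun x : V => (x, ξ)))
  have h2 : h = fun x => (∫ ξ, ψ ξ * planeWave x ξ).re := by
    ext x
    rw [← hh, Complex.ofReal_re]
  rw [h2]
  exact Complex.continuous_re.comp h1

lemma norm_le_of_eq_integral_planeWave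
    (hh : ∀ x, (h x : ℂ) = ∫ ξ, ψ ξ * planeWave x ξ) (x : V) : ‖h x‖ ≤ ∫ ξ, ‖ψ ξ‖ := by
  rw [← Complex.norm_real, hh]
  refine (norm_integral_le_integral_norm _).trans_eq ?_
  simp only [norm_mul, norm_planeWave, mul_one]

lemma integrableOn_kernel_mul (hψ : Integrable ψ)
    (hh : ∀ x, (h x : ℂ) = ∫ ξ, ψ ξ * planeWave x ξ) {k : V → ℝ} {S : Set V}
    (hk : IntegrableOn k S) (x : V) : IntegrableOn (fun w => k w * h (x + w)) S := by
  refine Integrable.mul_bdd (c := ∫ ξ, ‖ψ ξ‖) hk ?_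
    (ae_of_all _ fun w => norm_le_of_eq_integral_planeWave hh (x + w))
  exact ((continuous_of_eq_integral_planeWave hψ hh).comp
    (continuous_const.add continuous_id)).aestronglyMeasurable

lemma integrable_kernel_prod (hψ : Integrable ψ) {k : V → ℝ} {S : Set V}
    (hk : IntegrableOn k S) (x : V) :
    Integrable (Function.uncurry fun w ξ =>
      (ψ ξ * planeWave x ξ) * ((k w : ℂ) * (planeWave w ξ - 1)))
      ((volume.restrict S).prod volume) := by
  have h1 : Integrable (fun p : V × V => (k p.1 : ℂ) * (ψ p.2 * planeWave x p.2))
      ((volume.restrict S).prod volume) :=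
    Integrable.mul_prod (Integrable.ofReal hk) (integrable_mul_planeWave hψ x)
  have h2 := h1.mul_bdd (g := fun p : V × V => planeWave p.1 p.2 - 1) (c := 2)
    (continuous_planeWave.sub continuous_const).aestronglyMeasurable
    (ae_of_all _ fun p => by
      calc _ ≤ ‖planeWave p.1 p.2‖ + ‖(1 : ℂ)‖ := norm_sub_le _ _
        _ = 2 := by rw [norm_planeWave, norm_one]; norm_num)
  refine h2.congr (ae_of_all _ fun p => ?_)
  simp only [Function.uncurry]
  ring

lemma setIntegral_kernel_eq (hψ : Integrable ψ)
    (hh : ∀ x, (h x : ℂ) = ∫ ξ, ψ ξ * planeWave x ξ) {k : V → ℝ} {S : Set V}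
    (hk : IntegrableOn k S) (x : V) :
    ((∫ w in S, k w * (h (x + w) - h x) : ℝ) : ℂ) =
      ∫ ξ, (ψ ξ * planeWave x ξ) * ∫ w in S, (k w : ℂ) * (planeWave w ξ - 1) := by
  simp_rw [← integral_const_mul]
  rw [← integral_integral_swap (integrable_kernel_prod hψ hk x), ← integral_complex_ofReal]
  congr 1; ext w
  push_cast
  rw [hh, hh, ← integral_sub (integrable_mul_planeWave hψ _) (integrable_mul_planeWave hψ _),
    ← integral_const_mul]
  congr 1; ext ξ
  rw [planeWave_add]
  ring

/-- Truncated convolution integrals converge to the corresponding Fourier multiplier. -/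
theorem tendsto_truncated_integral {k : V → ℝ} (hkm : Measurable k) (hk0 : k 0 = 0)
    (hk : ∀ ε : ℝ, 0 < ε → IntegrableOn k {w | ε < ‖w‖})
    {D : V → V → ℂ} (hD : ∀ ξ, Continuous fun w => D w ξ)
    (hkD : ∀ ε : ℝ, 0 < ε → ∀ ξ, ∫ w in {w | ε < ‖w‖}, (k w : ℂ) * (planeWave w ξ - 1) =
      ∫ w in {w | ε < ‖w‖}, (k w : ℂ) * D w ξ)
    {m : V → ℝ} (hm : Integrable m) (hb : ∀ w ξ, ‖(k w : ℂ) * D w ξ‖ ≤ m w * (1 + ‖ξ‖) ^ 2)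
    (hψ : Integrable ψ) (hψ2 : Integrable fun ξ => (1 + ‖ξ‖) ^ 2 * ‖ψ ξ‖)
    (hh : ∀ x, (h x : ℂ) = ∫ ξ, ψ ξ * planeWave x ξ) (x : V) :
    ∃ r : ℝ, (r : ℂ) = ∫ ξ, (ψ ξ * planeWave x ξ) * ∫ w, (k w : ℂ) * D w ξ ∧
      Tendsto (fun ε : ℝ => ∫ w in {w | ε < ‖w‖}, k w * (h (x + w) - h x)) (𝓝[>] 0) (𝓝 r) := by
  have hS : ∀ ε : ℝ, MeasurableSet {w : V | ε < ‖w‖} := fun ε =>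
    measurableSet_lt measurable_const measurable_norm
  have hm0 : ∀ w, 0 ≤ m w := fun w => by
    have := (norm_nonneg _).trans (hb w 0)
    simpa using this
  have hmeas : ∀ ξ, AEStronglyMeasurable (fun w => (k w : ℂ) * D w ξ) := fun ξ =>
    (Complex.measurable_ofReal.comp hkm).aestronglyMeasurable.mul (hD ξ).aestronglyMeasurable
  have hint : ∀ ξ, Integrable fun w => (k w : ℂ) * D w ξ := fun ξ =>
    (hm.mul_const _).mono' (hmeas ξ) (ae_of_all _ fun w => hb w ξ)
  have hinner : ∀ ξ, Tendsto (fun ε : ℝ => ∫ w in {w | ε < ‖w‖}, (k w : ℂ) * (planeWave w ξ - 1))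
      (𝓝[>] 0) (𝓝 (∫ w, (k w : ℂ) * D w ξ)) := by
    intro ξ
    have h1 : Tendsto (fun ε : ℝ => ∫ w, {w : V | ε < ‖w‖}.indicator
        (fun w => (k w : ℂ) * D w ξ) w) (𝓝[>] 0) (𝓝 (∫ w, (k w : ℂ) * D w ξ)) := by
      refine tendsto_integral_filter_of_dominated_convergence (fun w => m w * (1 + ‖ξ‖) ^ 2)
        (.of_forall fun ε => (hmeas ξ).indicator (hS ε))
        (.of_forall fun ε => ae_of_all _ fun w =>
          (norm_indicator_le_norm_self _ _).trans (hb w ξ)) (hm.mul_const _)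
        (ae_of_all _ fun w => ?_)
      rcases eq_or_ne w 0 with rfl | hw
      · simp [hk0, Set.indicator]
      · refine tendsto_const_nhds.congr' ?_
        filter_upwards [Ioo_mem_nhdsGT (norm_pos_iff.mpr hw)] with ε hε
        rw [Set.indicator_of_mem]
        exact hε.2
    refine h1.congr' ?_
    filter_upwards [self_mem_nhdsWithin] with ε hε
    rw [hkD ε hε, integral_indicator (hS ε)]
  have hbound : ∀ ε : ℝ, 0 < ε → ∀ ξ,
      ‖∫ w in {w | ε < ‖w‖}, (k w : ℂ) * (planeWave w ξ - 1)‖ ≤ (∫ w, m w) * (1 + ‖ξ‖) ^ 2 := by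
    intro ε hε ξ
    rw [hkD ε hε, ← integral_mul_const]
    refine (norm_integral_le_integral_norm _).trans ?_
    refine (setIntegral_le_integral (hint ξ).norm (ae_of_all _ fun w => norm_nonneg _)).trans ?_
    exact integral_mono (hint ξ).norm (hm.mul_const _) fun w => hb w ξ
  have hlim : Tendsto (fun ε : ℝ => ((∫ w in {w | ε < ‖w‖}, k w * (h (x + w) - h x) : ℝ) : ℂ))
      (𝓝[>] 0) (𝓝 (∫ ξ, (ψ ξ * planeWave x ξ) * ∫ w, (k w : ℂ) * D w ξ)) := by
    have h1 : Tendsto (fun ε : ℝ => ∫ ξ, (ψ ξ * planeWave x ξ) *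
        ∫ w in {w | ε < ‖w‖}, (k w : ℂ) * (planeWave w ξ - 1))
        (𝓝[>] 0) (𝓝 (∫ ξ, (ψ ξ * planeWave x ξ) * ∫ w, (k w : ℂ) * D w ξ)) := by
      refine tendsto_integral_filter_of_dominated_convergence
        (fun ξ => (∫ w, m w) * ((1 + ‖ξ‖) ^ 2 * ‖ψ ξ‖)) ?_ ?_ (hψ2.const_mul _)
        (ae_of_all _ fun ξ => (hinner ξ).const_mul _)
      · filter_upwards [self_mem_nhdsWithin] with ε hε
        have := (integrable_kernel_prod hψ (hk ε hε) x).integral_prod_right.aestronglyMeasurable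
        simpa only [Function.uncurry_apply_pair, integral_const_mul] using this
      · filter_upwards [self_mem_nhdsWithin] with ε hε
        refine ae_of_all _ fun ξ => ?_
        rw [norm_mul, norm_mul, norm_planeWave, mul_one]
        calc _ ≤ ‖ψ ξ‖ * ((∫ w, m w) * (1 + ‖ξ‖) ^ 2) := by
              gcongr
              exact hbound ε hε ξ
          _ = _ := by ring
    refine h1.congr' ?_
    filter_upwards [self_mem_nhdsWithin] with ε hε
    exact (setIntegral_kernel_eq hψ hh (hk ε hε) x).symm
  set z := ∫ ξ, (ψ ξ * planeWave x ξ) * ∫ w, (k w : ℂ) * D w ξ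
  have hre := (Complex.continuous_re.tendsto z).comp hlim
  have him := (Complex.continuous_im.tendsto z).comp hlim
  have him0 : z.im = 0 := by
    refine tendsto_nhds_unique him ?_
    simp only [Function.comp_def, Complex.ofReal_im]
    exact tendsto_const_nhds
  refine ⟨z.re, Complex.ext (by simp) (by simp [him0]), ?_⟩
  simpa only [Function.comp_def, Complex.ofReal_re] using hre

end TruncatedKernel

section FractionalKernels

variable {V : Type*} [NormedAddCommGroup V] [InnerProductSpace ℝ V]

/-- A component of the kernel of the fractional gradient of order `γ`. -/
noncomputable def gradKernel (γ : ℝ) (b w : V) : ℝ :=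
  ⟪w, b⟫_ℝ * (‖w‖ ^ ((Module.finrank ℝ V : ℝ) + (γ + 1)))⁻¹

/-- A component of the kernel of the fractional Hessian of order `γ`. -/
noncomputable def hessKernel (γ : ℝ) (a b w : V) : ℝ :=
  (‖w‖ ^ ((Module.finrank ℝ V : ℝ) + γ))⁻¹ *
    (((Module.finrank ℝ V : ℝ) + γ) / ‖w‖ ^ 2 * (⟪w, a⟫_ℝ * ⟪w, b⟫_ℝ) - ⟪a, b⟫_ℝ)

lemma gradKernel_neg (γ : ℝ) (b w : V) : gradKernel γ b (-w) = -gradKernel γ b w := by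
  simp [gradKernel, inner_neg_left]

lemma hessKernel_neg (γ : ℝ) (a b w : V) : hessKernel γ a b (-w) = hessKernel γ a b w := by
  simp [hessKernel, inner_neg_left]

lemma abs_gradKernel_le (γ : ℝ) (b w : V) :
    |gradKernel γ b w| ≤ ‖b‖ * (‖w‖ ^ ((Module.finrank ℝ V : ℝ) + γ))⁻¹ := by
  rcases eq_or_ne w 0 with rfl | hw
  · simp only [gradKernel, inner_zero_left, zero_mul, abs_zero]
    positivity
  have hn : 0 < ‖w‖ := norm_pos_iff.mpr hw
  rw [gradKernel, abs_mul, abs_inv, abs_of_pos (Real.rpow_pos_of_pos hn _), ← add_assoc,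
    Real.rpow_add_one hn.ne', mul_inv]
  calc _ ≤ (‖w‖ * ‖b‖) * ((‖w‖ ^ ((Module.finrank ℝ V : ℝ) + γ))⁻¹ * ‖w‖⁻¹) := by
        gcongr
        exact abs_real_inner_le_norm w b
    _ = _ := by field_simp

lemma abs_hessKernel_le {γ : ℝ} (hγ : 0 < γ) (a b w : V) :
    |hessKernel γ a b w| ≤ (((Module.finrank ℝ V : ℝ) + γ) * (‖a‖ * ‖b‖) + ‖a‖ * ‖b‖) *
      (‖w‖ ^ ((Module.finrank ℝ V : ℝ) + γ))⁻¹ := by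
  have hd : 0 < (Module.finrank ℝ V : ℝ) + γ := by positivity
  rcases eq_or_ne w 0 with rfl | hw
  · simp [hessKernel, Real.zero_rpow hd.ne']
  have hn : 0 < ‖w‖ := norm_pos_iff.mpr hw
  rw [hessKernel, abs_mul, abs_inv, abs_of_pos (Real.rpow_pos_of_pos hn _), mul_comm]
  gcongr
  refine (abs_sub _ _).trans ?_
  gcongr
  · rw [abs_mul, abs_mul, abs_div, abs_of_pos hd, abs_of_nonneg (sq_nonneg ‖w‖)]
    calc _ ≤ ((Module.finrank ℝ V : ℝ) + γ) / ‖w‖ ^ 2 * ((‖w‖ * ‖a‖) * (‖w‖ * ‖b‖)) := by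
          gcongr <;> exact abs_real_inner_le_norm _ _
      _ = _ := by field_simp
  · exact abs_real_inner_le_norm a b

lemma hessKernel_zero {γ : ℝ} (hγ : 0 < γ) (a b : V) : hessKernel γ a b 0 = 0 := by
  have hd : (Module.finrank ℝ V : ℝ) + γ ≠ 0 := by positivity
  simp [hessKernel, Real.zero_rpow hd]

lemma norm_kernel_mul_le {γ C : ℝ} {p : ℕ} {k : V → ℝ} {D : V → V → ℂ}
    (hk : ∀ w, |k w| ≤ C * (‖w‖ ^ ((Module.finrank ℝ V : ℝ) + γ))⁻¹)
    (hD : ∀ w ξ, ‖D w ξ‖ ≤ 2 * min 1 (‖w‖ ^ p) * (1 + ‖ξ‖) ^ 2) (w ξ : V) :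
    ‖(k w : ℂ) * D w ξ‖ ≤ (2 * C * radialMajorant γ p w) * (1 + ‖ξ‖) ^ 2 := by
  rw [norm_mul, Complex.norm_real, Real.norm_eq_abs, radialMajorant]
  have h0 := (abs_nonneg _).trans (hk w)
  calc _ ≤ (C * (‖w‖ ^ ((Module.finrank ℝ V : ℝ) + γ))⁻¹) *
        (2 * min 1 (‖w‖ ^ p) * (1 + ‖ξ‖) ^ 2) := by
        gcongr
        · exact hk w
        · exact hD w ξ
    _ = _ := by ring

variable [FiniteDimensional ℝ V] [MeasurableSpace V] [BorelSpace V]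

lemma measurable_gradKernel (γ : ℝ) (b : V) : Measurable (gradKernel γ b) := by
  have := (show Continuous fun w : V => ⟪w, b⟫_ℝ by fun_prop).measurable
  unfold gradKernel
  fun_prop

lemma measurable_hessKernel (γ : ℝ) (a b : V) : Measurable (hessKernel γ a b) := by
  have := (show Continuous fun w : V => ⟪w, a⟫_ℝ by fun_prop).measurable
  have := (show Continuous fun w : V => ⟪w, b⟫_ℝ by fun_prop).measurable
  unfold hessKernel
  fun_prop

lemma setIntegral_norm_gt_comp_neg {F : Type*} [NormedAddCommGroup F] [NormedSpace ℝ F]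
    (g : V → F) (ε : ℝ) :
    ∫ w in {w | ε < ‖w‖}, g (-w) = ∫ w in {w | ε < ‖w‖}, g w := by
  have h := (Measure.measurePreserving_neg (volume : Measure V)).setIntegral_preimage_emb
    (MeasurableEquiv.neg V).measurableEmbedding g {w | ε < ‖w‖}
  simpa using h

variable [Nontrivial V]

lemma integrableOn_norm_gt {γ C : ℝ} (hγ : 0 < γ) {k : V → ℝ} (hkm : Measurable k)
    (hk : ∀ w, |k w| ≤ C * (‖w‖ ^ ((Module.finrank ℝ V : ℝ) + γ))⁻¹) {ε : ℝ} (hε : 0 < ε) :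
    IntegrableOn k {w | ε < ‖w‖} := by
  obtain ⟨p, hp⟩ := exists_nat_gt γ
  have hm : 0 < min 1 (ε ^ p) := by positivity
  have hi : IntegrableOn (fun w : V => C * ((min 1 (ε ^ p))⁻¹ * radialMajorant γ p w))
      {w | ε < ‖w‖} :=
    (((integrable_radialMajorant hγ hp).const_mul _).const_mul _).integrableOn
  refine Integrable.mono' hi hkm.aestronglyMeasurable ?_
  refine (ae_restrict_iff' (measurableSet_lt measurable_const measurable_norm)).mpr
    (ae_of_all _ fun w hw => ?_)
  have hw : ε < ‖w‖ := hw
  have hn : 0 < ‖w‖ := hε.trans hw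
  have hp0 : 0 < (‖w‖ ^ ((Module.finrank ℝ V : ℝ) + γ))⁻¹ := inv_pos.mpr (Real.rpow_pos_of_pos hn _)
  have hC : 0 ≤ C := nonneg_of_mul_nonneg_left ((abs_nonneg _).trans (hk w)) hp0
  refine (hk w).trans ?_
  rw [radialMajorant]
  have h1 : min 1 (ε ^ p) ≤ min 1 (‖w‖ ^ p) := by gcongr
  have h2 : 1 ≤ (min 1 (ε ^ p))⁻¹ * min 1 (‖w‖ ^ p) := by
    rw [inv_mul_eq_div, one_le_div hm]
    exact h1
  gcongr
  calc (‖w‖ ^ ((Module.finrank ℝ V : ℝ) + γ))⁻¹ =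
        (‖w‖ ^ ((Module.finrank ℝ V : ℝ) + γ))⁻¹ * 1 := (mul_one _).symm
    _ ≤ (‖w‖ ^ ((Module.finrank ℝ V : ℝ) + γ))⁻¹ *
        ((min 1 (ε ^ p))⁻¹ * min 1 (‖w‖ ^ p)) := by gcongr
    _ = _ := by ring

lemma integrableOn_gradKernel {γ : ℝ} (hγ : 0 < γ) (b : V) {ε : ℝ} (hε : 0 < ε) :
    IntegrableOn (gradKernel γ b) {w | ε < ‖w‖} :=
  integrableOn_norm_gt hγ (measurable_gradKernel γ b) (abs_gradKernel_le γ b) hε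

lemma integrableOn_hessKernel {γ : ℝ} (hγ : 0 < γ) (a b : V) {ε : ℝ} (hε : 0 < ε) :
    IntegrableOn (hessKernel γ a b) {w | ε < ‖w‖} :=
  integrableOn_norm_gt hγ (measurable_hessKernel γ a b) (abs_hessKernel_le hγ a b) hε

lemma integral_gradKernel_mul {γ : ℝ} (hγ : γ ∈ Set.Ioo 0 1) (b ξ : V) :
    ∫ w, (gradKernel γ b w : ℂ) * (planeWave w ξ - 1) =
      Complex.I * (⟪ξ, b⟫_ℝ * ‖ξ‖ ^ (γ - 1) *
        multiplierConst (Module.finrank ℝ V) (γ + 1) : ℝ) := by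
  have h := integral_inner_kernel (q := γ + 1) (by linarith [hγ.1]) (by linarith [hγ.2]) ξ b ?_
  · rw [show γ - 1 = γ + 1 - 2 by ring, ← h]
    congr 1; ext w
    rw [gradKernel]
    push_cast
    ring
  · have hm := (integrable_radialMajorant (V := V) (p := 1) hγ.1 (by simpa using hγ.2)).const_mul
      (2 * ‖b‖) |>.mul_const ((1 + ‖ξ‖) ^ 2)
    refine hm.mono' ?_ (ae_of_all _ fun w => ?_)
    · have h1 := (continuous_ofReal_inner b).measurable
      have h2 := (continuous_planeWave_left ξ).measurable
      exact Measurable.aestronglyMeasurable (by fun_prop)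
    · have := norm_kernel_mul_le (abs_gradKernel_le γ b) norm_planeWave_sub_one_le w ξ
      refine le_trans (le_of_eq ?_) this
      rw [gradKernel]
      push_cast
      ring_nf

lemma integral_hessKernel_mul {γ : ℝ} (hγ : γ ∈ Set.Ioo 0 2) (a b ξ : V) :
    ∫ w, (hessKernel γ a b w : ℂ) * evenWave w ξ =
      (-(⟪ξ, a⟫_ℝ * ⟪ξ, b⟫_ℝ * ‖ξ‖ ^ (γ - 2) * multiplierConst (Module.finrank ℝ V) γ) : ℝ) := by
  have hd : 0 < (Module.finrank ℝ V : ℝ) + γ := by have := hγ.1; positivity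
  have h1 := (continuous_ofReal_inner (V := V) a).measurable
  have h2 := (continuous_ofReal_inner (V := V) b).measurable
  have h3 := (continuous_evenWave_left ξ).measurable
  have hm : ∀ C : ℝ, Integrable fun w : V => (2 * C * radialMajorant γ 2 w) * (1 + ‖ξ‖) ^ 2 :=
    fun C => ((integrable_radialMajorant (V := V) (p := 2) hγ.1 (by exact_mod_cast hγ.2)).const_mul
      (2 * C)).mul_const ((1 + ‖ξ‖) ^ 2)
  have hi2 : Integrable fun w : V => (((⟪a, b⟫_ℝ : ℝ) : ℂ) * evenWave w ξ) *
      (((‖w‖ ^ ((Module.finrank ℝ V : ℝ) + γ))⁻¹ : ℝ) : ℂ) := by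
    refine (hm |⟪a, b⟫_ℝ|).mono' (Measurable.aestronglyMeasurable (by fun_prop))
      (ae_of_all _ fun w => ?_)
    have := norm_kernel_mul_le (γ := γ) (p := 2) (C := |⟪a, b⟫_ℝ|)
      (k := fun w => ⟪a, b⟫_ℝ * (‖w‖ ^ ((Module.finrank ℝ V : ℝ) + γ))⁻¹)
      (fun w => by rw [abs_mul, abs_of_nonneg (by positivity :
        0 ≤ (‖w‖ ^ ((Module.finrank ℝ V : ℝ) + γ))⁻¹)]) norm_evenWave_le w ξ
    refine le_trans (le_of_eq ?_) this
    push_cast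
    ring_nf
  have e : ∀ w : V, (hessKernel γ a b w : ℂ) * evenWave w ξ =
      (((Module.finrank ℝ V : ℝ) + γ : ℝ) : ℂ) *
        (((((⟪w, a⟫_ℝ : ℝ) : ℂ) * ((⟪w, b⟫_ℝ : ℝ) : ℂ)) * evenWave w ξ) *
        (((‖w‖ ^ ((Module.finrank ℝ V : ℝ) + γ + 2))⁻¹ : ℝ) : ℂ)) -
      (((⟪a, b⟫_ℝ : ℝ) : ℂ) * evenWave w ξ) *
        (((‖w‖ ^ ((Module.finrank ℝ V : ℝ) + γ))⁻¹ : ℝ) : ℂ) := by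
    intro w
    rcases eq_or_ne w 0 with rfl | hw
    · simp [hessKernel_zero hγ.1, Real.zero_rpow hd.ne']
    · have hn : 0 < ‖w‖ := norm_pos_iff.mpr hw
      rw [hessKernel, Real.rpow_add hn _ 2, Real.rpow_two]
      push_cast
      rw [mul_inv]
      ring
  have hik : Integrable fun w : V => (hessKernel γ a b w : ℂ) * evenWave w ξ :=
    (hm _).mono' ((Complex.measurable_ofReal.comp
      (measurable_hessKernel γ a b)).mul h3).aestronglyMeasurable
      (ae_of_all _ fun w => norm_kernel_mul_le (abs_hessKernel_le hγ.1 a b) norm_evenWave_le w ξ)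
  have hd' : ((((Module.finrank ℝ V : ℝ) + γ : ℝ)) : ℂ) ≠ 0 := by exact_mod_cast hd.ne'
  have hi1 : Integrable fun w : V =>
      ((((⟪w, a⟫_ℝ : ℝ) : ℂ) * ((⟪w, b⟫_ℝ : ℝ) : ℂ)) * evenWave w ξ) *
        (((‖w‖ ^ ((Module.finrank ℝ V : ℝ) + γ + 2))⁻¹ : ℝ) : ℂ) := by
    refine ((hik.add hi2).const_mul ((((Module.finrank ℝ V : ℝ) + γ : ℝ)) : ℂ)⁻¹).congr
      (ae_of_all _ fun w => ?_)
    simp only [Pi.add_apply]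
    rw [e, sub_add_cancel, inv_mul_cancel_left₀ hd']
  rw [← integral_hessian_kernel hγ.1 hγ.2 ξ a b hi1 hi2, ← integral_const_mul,
    ← integral_sub (hi1.const_mul _) hi2]
  exact integral_congr_ae (ae_of_all _ e)

variable {ψ : V → ℂ} {h : V → ℝ}

theorem exists_tendsto_gradKernel {γ : ℝ} (hγ : γ ∈ Set.Ioo 0 1) (b : V)
    (hψ : Integrable ψ) (hψ2 : Integrable fun ξ => (1 + ‖ξ‖) ^ 2 * ‖ψ ξ‖)
    (hh : ∀ x, (h x : ℂ) = ∫ ξ, ψ ξ * planeWave x ξ) (x : V) :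
    ∃ r : ℝ, (r : ℂ) = ∫ ξ, (ψ ξ * (Complex.I * (⟪ξ, b⟫_ℝ * ‖ξ‖ ^ (γ - 1) *
        multiplierConst (Module.finrank ℝ V) (γ + 1) : ℝ))) * planeWave x ξ ∧
      Tendsto (fun ε : ℝ => ∫ w in {w | ε < ‖w‖}, gradKernel γ b w * h (x + w))
        (𝓝[>] 0) (𝓝 r) := by
  obtain ⟨r, hr, ht⟩ := tendsto_truncated_integral (measurable_gradKernel γ b)
    (by simp [gradKernel]) (fun ε hε => integrableOn_gradKernel hγ.1 b hε)
    (D := fun w ξ => planeWave w ξ - 1)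
    (fun ξ => (continuous_planeWave_left ξ).sub continuous_const) (fun _ _ _ => rfl)
    ((integrable_radialMajorant (V := V) (p := 1) hγ.1 (by simpa using hγ.2)).const_mul (2 * ‖b‖))
    (norm_kernel_mul_le (abs_gradKernel_le γ b) norm_planeWave_sub_one_le) hψ hψ2 hh x
  refine ⟨r, ?_, ht.congr' ?_⟩
  · rw [hr]
    congr 1; ext ξ
    rw [integral_gradKernel_mul hγ]
    ring
  · filter_upwards [self_mem_nhdsWithin] with ε hε
    have hi := integrableOn_gradKernel hγ.1 b (Set.mem_Ioi.mp hε)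
    have h0 : ∫ w in {w | ε < ‖w‖}, gradKernel γ b w = 0 := by
      have h1 := setIntegral_norm_gt_comp_neg (gradKernel γ b) ε
      simp only [gradKernel_neg, integral_neg] at h1
      linarith
    simp only [mul_sub]
    rw [integral_sub (integrableOn_kernel_mul hψ hh hi x) (hi.mul_const _), integral_mul_const, h0,
      zero_mul, sub_zero]

theorem exists_tendsto_hessKernel {γ : ℝ} (hγ : γ ∈ Set.Ioo 0 2) (a b : V)
    (hψ : Integrable ψ) (hψ2 : Integrable fun ξ => (1 + ‖ξ‖) ^ 2 * ‖ψ ξ‖)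
    (hh : ∀ x, (h x : ℂ) = ∫ ξ, ψ ξ * planeWave x ξ) (x : V) :
    ∃ r : ℝ, (r : ℂ) = ∫ ξ, (ψ ξ * (-(⟪ξ, a⟫_ℝ * ⟪ξ, b⟫_ℝ * ‖ξ‖ ^ (γ - 2) *
        multiplierConst (Module.finrank ℝ V) γ) : ℝ)) * planeWave x ξ ∧
      Tendsto (fun ε : ℝ => ∫ w in {w | ε < ‖w‖}, hessKernel γ a b w * (h (x + w) - h x))
        (𝓝[>] 0) (𝓝 r) := by
  have hkD : ∀ ε > 0, ∀ ξ : V,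
      ∫ w in {w | ε < ‖w‖}, (hessKernel γ a b w : ℂ) * (planeWave w ξ - 1) =
        ∫ w in {w | ε < ‖w‖}, (hessKernel γ a b w : ℂ) * evenWave w ξ := by
    intro ε hε ξ
    have hi : IntegrableOn (fun w => (hessKernel γ a b w : ℂ)) {w | ε < ‖w‖} :=
      (integrableOn_hessKernel hγ.1 a b hε).ofReal
    have hp : ∀ η : V, IntegrableOn (fun w => (hessKernel γ a b w : ℂ) * planeWave w η)
        {w | ε < ‖w‖} := fun η =>
      Integrable.mul_bdd (c := 1) hi (continuous_planeWave_left η).aestronglyMeasurable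
        (ae_of_all _ fun w => (norm_planeWave w η).le)
    have hneg := setIntegral_norm_gt_comp_neg
      (fun w => (hessKernel γ a b w : ℂ) * planeWave w ξ) ε
    have e : ∀ w : V, planeWave (-w) ξ = planeWave w (-ξ) := fun w => by
      simp [planeWave, inner_neg_left, inner_neg_right]
    simp only [hessKernel_neg, e] at hneg
    have e1 : ∀ w : V, (hessKernel γ a b w : ℂ) * evenWave w ξ =
        ((hessKernel γ a b w : ℂ) * planeWave w ξ +
          (hessKernel γ a b w : ℂ) * planeWave w (-ξ)) / 2 - (hessKernel γ a b w : ℂ) := fun w => by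
      rw [evenWave]
      ring
    have hs : IntegrableOn (fun w => ((hessKernel γ a b w : ℂ) * planeWave w ξ +
          (hessKernel γ a b w : ℂ) * planeWave w (-ξ)) / 2) {w | ε < ‖w‖} :=
      ((hp ξ).add (hp (-ξ))).div_const 2
    simp only [e1, mul_sub, mul_one]
    rw [integral_sub (hp ξ) hi, integral_sub hs hi, integral_div,
      integral_add (hp ξ) (hp (-ξ)), hneg]
    ring
  obtain ⟨r, hr, ht⟩ := tendsto_truncated_integral (measurable_hessKernel γ a b)
    (hessKernel_zero hγ.1 a b) (fun ε hε => integrableOn_hessKernel hγ.1 a b hε)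
    (D := evenWave) continuous_evenWave_left hkD
    ((integrable_radialMajorant (V := V) (p := 2) hγ.1 (by exact_mod_cast hγ.2)).const_mul _)
    (norm_kernel_mul_le (abs_hessKernel_le hγ.1 a b) norm_evenWave_le) hψ hψ2 hh x
  refine ⟨r, ?_, ht⟩
  rw [hr]
  congr 1; ext ξ
  rw [integral_hessKernel_mul hγ]
  ring

end FractionalKernels

section FourierSide

variable {V : Type*} [NormedAddCommGroup V] [InnerProductSpace ℝ V] [FiniteDimensional ℝ V]
  [MeasurableSpace V] [BorelSpace V]

theorem SchwartzMap.exists_eq_integral_planeWave (f : 𝓢(V, ℝ)) :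
    ∃ ψ : 𝓢(V, ℂ), ∀ x, (f x : ℂ) = ∫ ξ, ψ ξ * planeWave x ξ := by
  have hπ : (2 * π)⁻¹ ≠ 0 := by positivity
  let F : 𝓢(V, ℂ) := f.postcompCLM Complex.ofRealCLM
  let g : 𝓢(V, ℂ) := FourierTransform.fourier F
  let d : 𝓢(V, ℂ) := SchwartzMap.compCLMOfContinuousLinearEquiv ℝ
    (ContinuousLinearEquiv.smulLeft (Units.mk0 (2 * π)⁻¹ hπ)) g
  refine ⟨(|(((2 * π)⁻¹) ^ Module.finrank ℝ V)⁻¹|)⁻¹ • d, fun x => ?_⟩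
  have h1 : (f x : ℂ) = FourierTransformInv.fourierInv g x := by
    rw [FourierPair.fourierInv_fourier_eq F]
    rfl
  have hd : ∀ ξ, d ξ = g ((2 * π)⁻¹ • ξ) := fun ξ => rfl
  have h2 := Measure.integral_comp_smul (volume : Measure V)
    (fun v => Complex.exp ((2 * π * ⟪v, x⟫_ℝ : ℝ) * Complex.I) • g v) (2 * π)⁻¹
  rw [h1, SchwartzMap.fourierInv_coe, Real.fourierInv_eq']
  have hne : |(((2 * π)⁻¹) ^ Module.finrank ℝ V)⁻¹| ≠ 0 := by positivity
  rw [← inv_smul_eq_iff₀ hne] at h2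
  rw [← h2, ← integral_smul]
  congr 1; ext ξ
  rw [smul_apply, hd, inner_smul_left, planeWave, smul_mul_assoc, smul_eq_mul,
    mul_comm (g _), real_inner_comm]
  congr 3
  simp
  field_simp

lemma SchwartzMap.integrable_one_add_norm_pow_mul (ψ : 𝓢(V, ℂ)) (k : ℕ) :
    Integrable fun ξ => (1 + ‖ξ‖) ^ k * ‖ψ ξ‖ := by
  refine (((ψ.integrable_pow_mul volume 0).add (ψ.integrable_pow_mul volume k)).const_mul
    (2 ^ (k - 1))).mono' (by fun_prop) (ae_of_all _ fun ξ => ?_)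
  rw [Real.norm_of_nonneg (by positivity)]
  have := add_pow_le zero_le_one (norm_nonneg ξ) k
  rw [one_pow] at this
  simp only [Pi.add_apply, pow_zero, ← add_mul, ← mul_assoc]
  gcongr

lemma SchwartzMap.integrable_one_add_norm_pow_mul_multiplier (ψ : 𝓢(V, ℂ)) (k : ℕ) {γ : ℝ}
    (hγ : γ ∈ Set.Ioo 0 1) (b : V) (c : ℝ) :
    Integrable fun ξ => (1 + ‖ξ‖) ^ k *
      ‖ψ ξ * (Complex.I * (⟪ξ, b⟫_ℝ * ‖ξ‖ ^ (γ - 1) * c : ℝ))‖ := by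
  refine ((ψ.integrable_one_add_norm_pow_mul (k + 1)).mul_const (‖b‖ * |c|)).mono'
    (Measurable.aestronglyMeasurable ?_) (ae_of_all _ fun ξ => ?_)
  · have := ψ.continuous.measurable
    fun_prop
  · have h : ‖ξ‖ * ‖ξ‖ ^ (γ - 1) ≤ 1 + ‖ξ‖ := by
      rcases eq_or_ne ξ 0 with rfl | hξ
      · simp
      · have hn : 0 < ‖ξ‖ := norm_pos_iff.mpr hξ
        rw [← Real.rpow_one_add' hn.le (by linarith [hγ.1]), add_sub_cancel]
        calc ‖ξ‖ ^ γ ≤ (1 + ‖ξ‖) ^ γ := Real.rpow_le_rpow hn.le (by linarith) hγ.1.le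
          _ ≤ (1 + ‖ξ‖) ^ (1 : ℝ) := Real.rpow_le_rpow_of_exponent_le (by linarith) hγ.2.le
          _ = 1 + ‖ξ‖ := Real.rpow_one _
    rw [Real.norm_of_nonneg (by positivity)]
    simp only [norm_mul, Complex.norm_I, one_mul, Complex.norm_real, Real.norm_eq_abs,
      abs_of_nonneg (Real.rpow_nonneg (norm_nonneg ξ) _)]
    calc (1 + ‖ξ‖) ^ k * (‖ψ ξ‖ * (|⟪ξ, b⟫_ℝ| * ‖ξ‖ ^ (γ - 1) * |c|))
        ≤ (1 + ‖ξ‖) ^ k * (‖ψ ξ‖ * (‖ξ‖ * ‖b‖ * ‖ξ‖ ^ (γ - 1) * |c|)) := by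
          gcongr
          exact abs_real_inner_le_norm ξ b
      _ = (1 + ‖ξ‖) ^ k * ‖ψ ξ‖ * (‖ξ‖ * ‖ξ‖ ^ (γ - 1)) * (‖b‖ * |c|) := by ring
      _ ≤ (1 + ‖ξ‖) ^ k * ‖ψ ξ‖ * (1 + ‖ξ‖) * (‖b‖ * |c|) := by gcongr
      _ = (1 + ‖ξ‖) ^ (k + 1) * ‖ψ ξ‖ * (‖b‖ * |c|) := by ring

lemma SchwartzMap.integrable_mul_multiplier (ψ : 𝓢(V, ℂ)) {γ : ℝ} (hγ : γ ∈ Set.Ioo 0 1) (b : V)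
    (c : ℝ) : Integrable fun ξ => ψ ξ * (Complex.I * (⟪ξ, b⟫_ℝ * ‖ξ‖ ^ (γ - 1) * c : ℝ)) := by
  refine (integrable_norm_iff (Measurable.aestronglyMeasurable ?_)).mp ?_
  · have := ψ.continuous.measurable
    fun_prop
  · simpa using ψ.integrable_one_add_norm_pow_mul_multiplier 0 hγ b c

end FourierSide

lemma muConst_mul_multiplierConst (n : ℕ) {γ : ℝ} (hγ : γ ∈ Set.Ioo 0 1) :
    muConst n γ * multiplierConst n (γ + 1) = 1 := by
  have h1 : 0 < Real.Gamma (((n : ℝ) + γ + 1) / 2) :=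
    Real.Gamma_pos_of_pos (by have := hγ.1; positivity)
  have h2 : 0 < Real.Gamma ((1 - γ) / 2) := Real.Gamma_pos_of_pos (by linarith [hγ.2])
  have h3 : (2 : ℝ) ^ (1 - (γ + 1)) * 2 ^ γ = 1 := by
    rw [← Real.rpow_add two_pos]; simp
  rw [muConst, multiplierConst, show 1 - (γ + 1) / 2 = (1 - γ) / 2 by ring, ← add_assoc]
  have h4 : 0 < π ^ ((n : ℝ) / 2) := by positivity
  field_simp
  linear_combination h3

lemma nuConst_mul_multiplierConst (n : ℕ) {γ : ℝ} (hγ : γ ∈ Set.Ioo 0 2) :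
    -nuConst n γ / γ * multiplierConst n γ = 1 := by
  have h0 := hγ.1
  have h1 : 0 < Real.Gamma (((n : ℝ) + γ) / 2) := Real.Gamma_pos_of_pos (by positivity)
  have h2 : 0 < Real.Gamma (1 - γ / 2) := Real.Gamma_pos_of_pos (by linarith [hγ.2])
  have h5 : Real.Gamma (1 - γ / 2) = -γ / 2 * Real.Gamma (-γ / 2) := by
    rw [← Real.Gamma_add_one (by linarith)]; ring_nf
  have h6 : Real.Gamma (-γ / 2) ≠ 0 := fun h => by simp [h5, h] at h2
  have h3 : (2 : ℝ) ^ (1 - γ) * 2 ^ γ = 2 := by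
    rw [← Real.rpow_add two_pos]; simp
  rw [nuConst, multiplierConst, h5]
  rw [neg_div 2 γ] at h6 ⊢
  have h4 : 0 < π ^ ((n : ℝ) / 2) := by positivity
  field_simp
  linear_combination h3

section Assembly

lemma setIntegral_norm_sub_gt {V F : Type*} [NormedAddCommGroup V] [MeasurableSpace V]
    [BorelSpace V] [NormedAddCommGroup F] [NormedSpace ℝ F] (μ : Measure V)
    [μ.IsAddLeftInvariant] (u : V → F) (y : V) (ε : ℝ) :
    ∫ z in {z | ε < ‖z - y‖}, u z ∂μ = ∫ w in {w | ε < ‖w‖}, u (y + w) ∂μ := by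
  rw [← (measurePreserving_add_left μ y).setIntegral_preimage_emb
    (measurableEmbedding_addLeft y)]
  simp

lemma tendsto_setIntegral_sum_smul {X F ι : Type*} [MeasurableSpace X] {μ : Measure X}
    [NormedAddCommGroup F] [NormedSpace ℝ F] [CompleteSpace F] [Fintype ι] {S : ℝ → Set X}
    {k : ι → X → ℝ} (e : ι → F) {r : ι → ℝ} (hi : ∀ i, ∀ ε > 0, IntegrableOn (k i) (S ε) μ)
    (ht : ∀ i, Tendsto (fun ε => ∫ w in S ε, k i w ∂μ) (𝓝[>] 0) (𝓝 (r i))) :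
    Tendsto (fun ε => ∫ w in S ε, ∑ i, k i w • e i ∂μ) (𝓝[>] 0) (𝓝 (∑ i, r i • e i)) := by
  refine (tendsto_finsetSum _ fun i _ => (ht i).smul_const (e i)).congr' ?_
  filter_upwards [self_mem_nhdsWithin] with ε hε
  rw [integral_finsetSum _ fun i _ => (hi i ε hε).smul_const (e i)]
  simp only [integral_smul_const]

lemma sum_smul_outer_basisFun {n : ℕ}
    (A : EuclideanSpace ℝ (Fin n) →L[ℝ] EuclideanSpace ℝ (Fin n)) :
    ∑ p : Fin n × Fin n, ⟪EuclideanSpace.basisFun (Fin n) ℝ p.1,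
      A (EuclideanSpace.basisFun (Fin n) ℝ p.2)⟫_ℝ •
        outer (EuclideanSpace.basisFun (Fin n) ℝ p.1) (EuclideanSpace.basisFun (Fin n) ℝ p.2) =
      A := by
  set e := EuclideanSpace.basisFun (Fin n) ℝ
  refine ContinuousLinearMap.coe_injective (e.toBasis.ext fun j => ?_)
  simp only [OrthonormalBasis.coe_toBasis, ContinuousLinearMap.coe_coe,
    sum_apply, Fintype.sum_prod_type]
  rw [← e.sum_repr' (A (e j))]
  refine Finset.sum_congr rfl fun i _ => ?_
  rw [Finset.sum_eq_single j]
  · simp [outer]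
  · intro k _ hk
    simp [outer, e.inner_eq_zero hk]
  · simp

/-- Composing the Fourier multipliers of two fractional gradients gives, up to the normalizing
constants, the multiplier of the fractional Hessian. -/
lemma muConst_mul_eq_nuConst_mul {V : Type*} [NormedAddCommGroup V] [InnerProductSpace ℝ V]
    [MeasurableSpace V] {μ : Measure V} (n : ℕ) {α β : ℝ}
    (hα : α ∈ Set.Ioo 0 1) (hβ : β ∈ Set.Ioo 0 1) {ψ : V → ℂ} {a b x : V} {H M : ℝ}
    (hH : (H : ℂ) = ∫ ξ, (ψ ξ * (Complex.I * (⟪ξ, a⟫_ℝ * ‖ξ‖ ^ (β - 1) *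
      multiplierConst n (β + 1) : ℝ)) * (Complex.I * (⟪ξ, b⟫_ℝ * ‖ξ‖ ^ (α - 1) *
      multiplierConst n (α + 1) : ℝ))) * planeWave x ξ ∂μ)
    (hM : (M : ℂ) = ∫ ξ, (ψ ξ * (-(⟪ξ, a⟫_ℝ * ⟪ξ, b⟫_ℝ * ‖ξ‖ ^ (α + β - 2) *
      multiplierConst n (α + β)) : ℝ)) * planeWave x ξ ∂μ) :
    muConst n α * (muConst n β * H) = -nuConst n (α + β) / (α + β) * M := by
  have h1 := muConst_mul_multiplierConst n hα
  have h2 := muConst_mul_multiplierConst n hβ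
  have h3 := nuConst_mul_multiplierConst n (γ := α + β)
    ⟨by linarith [hα.1, hβ.1], by linarith [hα.2, hβ.2]⟩
  apply Complex.ofReal_injective
  rw [Complex.ofReal_mul, Complex.ofReal_mul, Complex.ofReal_mul, hH, hM, ← mul_assoc,
    ← integral_const_mul, ← integral_const_mul]
  congr 1; ext ξ
  have hr : ⟪ξ, a⟫_ℝ * ⟪ξ, b⟫_ℝ * (‖ξ‖ ^ (β - 1) * ‖ξ‖ ^ (α - 1)) =
      ⟪ξ, a⟫_ℝ * ⟪ξ, b⟫_ℝ * ‖ξ‖ ^ (α + β - 2) := by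
    rcases eq_or_ne ξ 0 with rfl | hξ
    · simp
    · rw [← Real.rpow_add (norm_pos_iff.mpr hξ)]
      ring_nf
  have key : muConst n α * muConst n β * ((⟪ξ, a⟫_ℝ * ‖ξ‖ ^ (β - 1) * multiplierConst n (β + 1)) *
      (⟪ξ, b⟫_ℝ * ‖ξ‖ ^ (α - 1) * multiplierConst n (α + 1))) =
      -nuConst n (α + β) / (α + β) * (⟪ξ, a⟫_ℝ * ⟪ξ, b⟫_ℝ * ‖ξ‖ ^ (α + β - 2) *
      multiplierConst n (α + β)) := by
    calc _ = (muConst n α * multiplierConst n (α + 1)) * (muConst n β * multiplierConst n (β + 1)) *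
          (⟪ξ, a⟫_ℝ * ⟪ξ, b⟫_ℝ * (‖ξ‖ ^ (β - 1) * ‖ξ‖ ^ (α - 1))) := by ring
      _ = (-nuConst n (α + β) / (α + β) * multiplierConst n (α + β)) *
          (⟪ξ, a⟫_ℝ * ⟪ξ, b⟫_ℝ * ‖ξ‖ ^ (α + β - 2)) := by rw [h1, h2, h3, hr, one_mul]
      _ = _ := by ring
  have keyC := congrArg (fun r : ℝ => (r : ℂ)) key
  push_cast at keyC ⊢
  linear_combination (Complex.I * Complex.I * ψ ξ * planeWave x ξ) * keyC +
    (-(nuConst n (α + β) : ℂ) / (α + β) * (((⟪ξ, a⟫_ℝ : ℝ) : ℂ) * ((⟪ξ, b⟫_ℝ : ℝ) : ℂ) *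
      ((‖ξ‖ ^ (α + β - 2) : ℝ) : ℂ) * (multiplierConst n (α + β) : ℂ)) * ψ ξ * planeWave x ξ) *
      Complex.I_mul_I

end Assembly

/-- **Fractional Hessian formula.** For a Schwartz function `f`, the fractional gradient
`∇^β f` exists everywhere (as the principal-value limit defining it, here the function `G`),
the second fractional gradient `∇^α(∇^β f)(x)` exists at every `x` (as a principal-value
limit), and it equals
`(−ν_{α+β}/(α+β)) · p.v. ∫ ((f(x+v) − f(x))/|v|^{n+α+β}) (((n+α+β)/|v|²) v ⊗ v − Id) dv`. -/
theorem fractional_hessian (n : ℕ) (hn : 1 ≤ n) (α β : ℝ) (hα : α ∈ Set.Ioo 0 1)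
    (hβ : β ∈ Set.Ioo 0 1) (f : 𝓢(EuclideanSpace ℝ (Fin n), ℝ)) :
    ∃ G : EuclideanSpace ℝ (Fin n) → EuclideanSpace ℝ (Fin n),
      (∀ y : EuclideanSpace ℝ (Fin n),
        Tendsto
          (fun ε : ℝ => muConst n β •
            ∫ z in {z : EuclideanSpace ℝ (Fin n) | ε < ‖z - y‖},
              (f z / ‖y - z‖ ^ ((n : ℝ) + β + 1)) • (z - y))
          (𝓝[>] 0) (𝓝 (G y))) ∧
      ∀ x : EuclideanSpace ℝ (Fin n),
        ∃ M : EuclideanSpace ℝ (Fin n) →L[ℝ] EuclideanSpace ℝ (Fin n),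
          Tendsto
            (fun ε : ℝ =>
              ∫ v in {v : EuclideanSpace ℝ (Fin n) | ε < ‖v‖},
                ((f (x + v) - f x) / ‖v‖ ^ ((n : ℝ) + α + β)) •
                  ((((n : ℝ) + α + β) / ‖v‖ ^ 2) • outer v v -
                    ContinuousLinearMap.id ℝ (EuclideanSpace ℝ (Fin n))))
            (𝓝[>] 0) (𝓝 M) ∧
          Tendsto
            (fun ε : ℝ => muConst n α •
              ∫ y in {y : EuclideanSpace ℝ (Fin n) | ε < ‖y - x‖},
                (‖x - y‖ ^ ((n : ℝ) + α + 1))⁻¹ • outer (G y) (y - x))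
            (𝓝[>] 0) (𝓝 ((-nuConst n (α + β) / (α + β)) • M)) := by
  have : Nonempty (Fin n) := ⟨⟨0, hn⟩⟩
  have hd : (Module.finrank ℝ (EuclideanSpace ℝ (Fin n)) : ℝ) = n := by
    rw [finrank_euclideanSpace_fin]
  set e := EuclideanSpace.basisFun (Fin n) ℝ with he
  obtain ⟨ψ, hf⟩ := f.exists_eq_integral_planeWave
  have hψ2 := ψ.integrable_one_add_norm_pow_mul 2
  have hαβ : α + β ∈ Set.Ioo 0 2 := ⟨by linarith [hα.1, hβ.1], by linarith [hα.2, hβ.2]⟩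
  have hψi := fun i => ψ.integrable_mul_multiplier hβ (e i)
    (multiplierConst (Module.finrank ℝ (EuclideanSpace ℝ (Fin n))) (β + 1))
  choose g hg hgt using fun i y =>
    exists_tendsto_gradKernel hβ (e i) ψ.integrable hψ2 hf y
  choose H hH hHt using fun i j x => exists_tendsto_gradKernel hα (e j) (hψi i)
    (ψ.integrable_one_add_norm_pow_mul_multiplier 2 hβ (e i) _) (hg i) x
  choose M hM hMt using fun i j x => exists_tendsto_hessKernel hαβ (e i) (e j) ψ.integrable hψ2 hf x
  refine ⟨fun y => muConst n β • ∑ i, g i y • e i, fun y => ?_, fun x =>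
    ⟨∑ p : Fin n × Fin n, M p.1 p.2 x • outer (e p.1) (e p.2), ?_, ?_⟩⟩
  · refine Tendsto.const_smul ?_ _
    convert tendsto_setIntegral_sum_smul e (fun i ε hε => integrableOn_kernel_mul ψ.integrable hf
      (integrableOn_gradKernel hβ.1 (e i) hε) y) (fun i => hgt i y) using 2 with ε
    rw [setIntegral_norm_sub_gt]
    congr 1; ext1 w
    conv_lhs => rw [add_sub_cancel_left, ← e.sum_repr' w, Finset.smul_sum]
    refine Finset.sum_congr rfl fun i _ => ?_
    rw [smul_smul, gradKernel, hd, e.sum_repr' w, sub_add_cancel_left, norm_neg, real_inner_comm,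
      ← add_assoc]
    congr 1
    ring
  · have hi : ∀ p : Fin n × Fin n, ∀ ε > 0, IntegrableOn (fun w =>
        hessKernel (α + β) (e p.1) (e p.2) w * (f (x + w) - f x)) {w | ε < ‖w‖} := by
      intro p ε hε
      have hk := integrableOn_hessKernel hαβ.1 (e p.1) (e p.2) hε
      simp only [mul_sub]
      exact (integrableOn_kernel_mul ψ.integrable hf hk x).sub (hk.mul_const (f x))
    convert tendsto_setIntegral_sum_smul (fun p : Fin n × Fin n => outer (e p.1) (e p.2)) hi
      (fun p => hMt p.1 p.2 x) using 2 with ε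
    congr 1; ext1 w
    rw [← sum_smul_outer_basisFun (_ • (_ - _))]
    refine Finset.sum_congr rfl fun p _ => ?_
    congr 1
    simp only [outer, smul_apply, sub_apply,
      ContinuousLinearMap.smulRight_apply, innerSL_apply_apply, ContinuousLinearMap.id_apply,
      inner_smul_right, inner_sub_right, hessKernel, hd, ← he, real_inner_comm w,
      ← add_assoc]
    ring
  · have hlim : (-nuConst n (α + β) / (α + β)) •
        ∑ p : Fin n × Fin n, M p.1 p.2 x • outer (e p.1) (e p.2) =
        muConst n α • ∑ p : Fin n × Fin n, H p.1 p.2 x • muConst n β • outer (e p.1) (e p.2) := by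
      simp only [Finset.smul_sum, smul_smul]
      refine Finset.sum_congr rfl fun p _ => ?_
      have h1 := hH p.1 p.2 x
      have h2 := hM p.1 p.2 x
      rw [finrank_euclideanSpace_fin] at h1 h2
      rw [← muConst_mul_eq_nuConst_mul n hα hβ h1 h2, mul_comm (H _ _ _)]
    rw [hlim]
    refine ((tendsto_setIntegral_sum_smul
      (fun p : Fin n × Fin n => muConst n β • outer (e p.1) (e p.2))
      (fun p ε hε => integrableOn_kernel_mul (hψi p.1) (hg p.1)
        (integrableOn_gradKernel hα.1 (e p.2) hε) x)
      (fun p => hHt p.1 p.2 x)).const_smul (muConst n α)).congr fun ε => ?_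
    rw [setIntegral_norm_sub_gt]
    congr 2; ext1 w
    rw [← sum_smul_outer_basisFun (_ • outer _ _)]
    refine Finset.sum_congr rfl fun p _ => ?_
    rw [smul_smul]
    congr 1
    have hG : ⟪e p.1, ∑ i, g i (x + w) • e i⟫_ℝ = g p.1 (x + w) := by
      rw [inner_sum, Finset.sum_eq_single p.1]
      · simp [inner_smul_right]
      · intro k _ hk
        simp [inner_smul_right, e.inner_eq_zero hk.symm]
      · simp
    simp only [outer, smul_apply, ContinuousLinearMap.smulRight_apply, innerSL_apply_apply,
      inner_smul_right, ← he, hG, gradKernel, hd, add_sub_cancel_left, sub_add_cancel_left,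
      norm_neg, ← add_assoc]
    ring
end
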